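/- arXiv:2004.09435 — 8 statements merged into one kernel-verified Lean document; each statement's English description precedes it below -/
import Mathlib

section
/- Let ρ be a quasi-Banach function norm over a σ-finite measure space (R,μ) with modulus of concavity C, and X the corresponding quasi-Banach function space. Then X has the Riesz–Fischer property with constant C: for every sequence (f_n) in X with ∑_{n=0}^{∞} C^{n+1}·‖f_n‖_X < ∞, the series ∑_{n=0}^{∞} f_n converges μ-a.e. to a function f ∈ X and ‖f − ∑_{n=0}^{N} f_n‖_X → 0 as N → ∞. -/
open MeasureTheory Filter Set Topology
open scoped ENNReal NNReal

noncomputable section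

/-- A quasi-Banach function norm over the measure space `(α, μ)`:
a functional `ρ : M⁺ → [0,∞]` (acting on measurable functions `α → [0,∞]`,
respecting a.e. equality) with modulus of concavity `C`, satisfying
(Q1a) positive homogeneity, (Q1b) nondegeneracy, (Q1c) the quasi-triangle
inequality, (P2) the lattice property, (P3) the Fatou property and
(P4) finiteness on characteristic functions of sets of finite measure. -/
structure QBFNorm {α : Type*} [MeasurableSpace α] (μ : Measure α) where
  ρ : (α → ℝ≥0∞) → ℝ≥0∞
  C : ℝ≥0
  one_le_C : 1 ≤ C
  congr_ae : ∀ f g : α → ℝ≥0∞, Measurable f → Measurable g → f =ᵐ[μ] g → ρ f = ρ g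
  smul_hom : ∀ (a : ℝ≥0) (f : α → ℝ≥0∞), Measurable f →
    ρ (fun x => (a : ℝ≥0∞) * f x) = (a : ℝ≥0∞) * ρ f
  eq_zero_iff : ∀ f : α → ℝ≥0∞, Measurable f → (ρ f = 0 ↔ f =ᵐ[μ] 0)
  triangle : ∀ f g : α → ℝ≥0∞, Measurable f → Measurable g →
    ρ (fun x => f x + g x) ≤ (C : ℝ≥0∞) * (ρ f + ρ g)
  mono : ∀ f g : α → ℝ≥0∞, Measurable f → Measurable g →
    (∀ᵐ x ∂μ, f x ≤ g x) → ρ f ≤ ρ g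
  fatou : ∀ f : ℕ → α → ℝ≥0∞, (∀ n, Measurable (f n)) →
    (∀ᵐ x ∂μ, Monotone fun n => f n x) →
    ρ (fun x => ⨆ n, f n x) = ⨆ n, ρ (f n)
  indicator_lt_top : ∀ E : Set α, MeasurableSet E → μ E < ⊤ →
    ρ (E.indicator fun _ => 1) < ⊤

/-- The quasinorm `‖f‖_X = ρ(|f|)` of a vector-valued function. -/
def Xnorm {α : Type*} [MeasurableSpace α] {μ : Measure α} (Q : QBFNorm μ)
    {E : Type*} [NormedAddCommGroup E] (f : α → E) : ℝ≥0∞ :=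
  Q.ρ fun x => (‖f x‖₊ : ℝ≥0∞)

theorem qb_finite_sum {α : Type*} [MeasurableSpace α] {μ : Measure α} (Q : QBFNorm μ) (N : ℕ) :
    ∀ a : ℕ → α → ℝ≥0∞, (∀ n, Measurable (a n)) →
      Q.ρ (fun x => ∑ n ∈ Finset.range N, a n x) ≤
        ∑ n ∈ Finset.range N, (Q.C : ℝ≥0∞) ^ (n + 1) * Q.ρ (a n) := by
  induction N with
  | zero =>
    intro a ha
    have : Q.ρ (fun _ => 0) = 0 := (Q.eq_zero_iff _ measurable_const).2 (Eventually.of_forall fun _ => rfl)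
    simp [this]
  | succ N ih =>
    intro a ha
    simp only [Finset.sum_range_succ']
    refine (Q.triangle _ _ (Finset.measurable_fun_sum _ fun n _ => ha (n + 1)) (ha 0)).trans ?_
    refine (mul_le_mul_right (add_le_add_left (ih (fun n => a (n + 1)) fun n => ha _) _) _).trans ?_
    rw [mul_add, Finset.mul_sum]
    refine add_le_add (Finset.sum_le_sum fun n _ => ?_) ?_
    · rw [← mul_assoc, ← pow_succ']
    · simp

theorem qb_tsum {α : Type*} [MeasurableSpace α] {μ : Measure α} (Q : QBFNorm μ)
    (a : ℕ → α → ℝ≥0∞) (ha : ∀ n, Measurable (a n)) :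
    Q.ρ (fun x => ∑' n, a n x) ≤ ∑' n, (Q.C : ℝ≥0∞) ^ (n + 1) * Q.ρ (a n) := by
  simp_rw [ENNReal.tsum_eq_iSup_nat]
  rw [Q.fatou (fun N x => ∑ n ∈ Finset.range N, a n x)
    (fun N => Finset.measurable_fun_sum _ fun n _ => ha n)]
  · exact iSup_mono fun N => qb_finite_sum Q N a ha
  · refine Eventually.of_forall fun x m n hmn => ?_
    exact Finset.sum_le_sum_of_subset (Finset.range_mono hmn)

theorem qb_ae_lt_top {α : Type*} [MeasurableSpace α] {μ : Measure α} (Q : QBFNorm μ)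
    (h : α → ℝ≥0∞) (hm : Measurable h) (hh : Q.ρ h < ⊤) : ∀ᵐ x ∂μ, h x < ⊤ := by
  have hE : MeasurableSet {x | h x = ⊤} := hm (measurableSet_singleton ⊤)
  have hi : Measurable ({x | h x = ⊤}.indicator (fun _ => (1 : ℝ≥0∞))) :=
    measurable_const.indicator hE
  have key : ∀ n : ℕ, (n : ℝ≥0∞) * Q.ρ ({x | h x = ⊤}.indicator (fun _ => (1 : ℝ≥0∞))) ≤ Q.ρ h := by
    intro n
    have h1 := Q.smul_hom n _ hi
    simp only [ENNReal.coe_natCast] at h1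
    rw [← h1]
    refine Q.mono _ _ (hi.const_mul _) hm (Eventually.of_forall fun x => ?_)
    by_cases hx : h x = ⊤ <;> simp [Set.indicator, hx]
  have hz : Q.ρ ({x | h x = ⊤}.indicator (fun _ => (1 : ℝ≥0∞))) = 0 := by
    by_contra hne
    obtain ⟨n, hn⟩ := ENNReal.exists_nat_mul_gt hne hh.ne
    exact absurd (key n) (not_le.2 hn)
  filter_upwards [(Q.eq_zero_iff _ hi).1 hz] with x hx
  rw [lt_top_iff_ne_top]
  intro hx'
  simp [Set.indicator, hx'] at hx

/-- A quasi-Banach function space `X` with modulus of concavity `C` has the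
Riesz–Fischer property with constant `C`: if `∑ C^(n+1) * ‖f n‖_X < ∞`, then the
series `∑ f n` converges `μ`-a.e. to some `g ∈ X` and
`‖g − ∑_{n=0}^{N} f n‖_X → 0`. -/
theorem stmt_6 {α : Type*} [MeasurableSpace α] (μ : Measure α) [SigmaFinite μ]
    (Q : QBFNorm μ)
    (f : ℕ → α → ℂ) (hf : ∀ n, Measurable (f n)) (hfX : ∀ n, Xnorm Q (f n) < ⊤)
    (hsum : ∑' n : ℕ, (Q.C : ℝ≥0∞) ^ (n + 1) * Xnorm Q (f n) < ⊤) :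
    ∃ g : α → ℂ, Measurable g ∧ Xnorm Q g < ⊤ ∧
      (∀ᵐ x ∂μ, Tendsto (fun N => ∑ n ∈ Finset.range (N + 1), f n x) atTop (nhds (g x))) ∧
      Tendsto (fun N => Xnorm Q (fun x => g x - ∑ n ∈ Finset.range (N + 1), f n x))
        atTop (nhds 0) := by
  have hC : (1 : ℝ≥0∞) ≤ Q.C := by exact_mod_cast Q.one_le_C
  have ha : ∀ n, Measurable (fun x => ‖f n x‖ₑ) := fun n => (hf n).enorm
  have hXn : ∀ u : α → ℂ, Xnorm Q u = Q.ρ (fun x => ‖u x‖ₑ) := fun u => rfl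
  simp only [hXn] at hsum hfX ⊢
  have hm : Measurable (fun x => ∑' n, ‖f n x‖ₑ) := Measurable.ennreal_tsum ha
  have hfin := (qb_tsum Q _ ha).trans_lt hsum
  have hae := qb_ae_lt_top Q _ hm hfin
  have hE : MeasurableSet {x | ∑' n, ‖f n x‖ₑ < ⊤} := hm measurableSet_Iio
  have hS : ∀ x, ∑' n, ‖f n x‖ₑ < ⊤ → Summable fun n => f n x := by
    intro x hx
    refine Summable.of_nnnorm ?_
    exact ENNReal.tsum_coe_ne_top_iff_summable.1 hx.ne
  let g : α → ℂ := {x | ∑' n, ‖f n x‖ₑ < ⊤}.indicator fun x => ∑' n, f n x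
  have hgm : Measurable g := by
    refine measurable_of_tendsto_metrizable
      (f := fun N => {x | ∑' n, ‖f n x‖ₑ < ⊤}.indicator fun x => ∑ n ∈ Finset.range N, f n x)
      (fun N => (Finset.measurable_fun_sum _ fun n _ => hf n).indicator hE) ?_
    rw [tendsto_pi_nhds]
    intro x
    by_cases hx : ∑' n, ‖f n x‖ₑ < ⊤
    · simpa [g, Set.indicator, hx] using (hS x hx).hasSum.tendsto_sum_nat
    · simp [g, Set.indicator, hx]
  have hgx : ∀ x, ∑' n, ‖f n x‖ₑ < ⊤ → g x = ∑' n, f n x := by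
    intro x hx
    exact Set.indicator_of_mem (s := {x | ∑' n, ‖f n x‖ₑ < ⊤}) hx _
  refine ⟨g, hgm, ?_, ?_, ?_⟩
  · refine (Q.mono _ _ hgm.enorm hm ?_).trans_lt hfin
    filter_upwards [hae] with x hx
    rw [hgx x hx]
    exact enorm_tsum_le_tsum_enorm
  · filter_upwards [hae] with x hx
    rw [hgx x hx]
    exact (tendsto_add_atTop_iff_nat 1).2 (hS x hx).hasSum.tendsto_sum_nat
  · have hlim := (tendsto_add_atTop_iff_nat 1).2 (ENNReal.tendsto_sum_nat_add _ hsum.ne)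
    refine tendsto_of_tendsto_of_tendsto_of_le_of_le tendsto_const_nhds hlim
      (fun _ => zero_le) fun N => ?_
    have ha' : ∀ n, Measurable (fun x => ‖f (n + (N + 1)) x‖ₑ) := fun n => ha _
    have h1 : Q.ρ (fun x => ‖g x - ∑ n ∈ Finset.range (N + 1), f n x‖ₑ) ≤
        Q.ρ (fun x => ∑' n, ‖f (n + (N + 1)) x‖ₑ) := by
      refine Q.mono _ _ (hgm.sub (Finset.measurable_fun_sum _ fun n _ => hf n)).enorm
        (Measurable.ennreal_tsum ha') ?_
      filter_upwards [hae] with x hx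
      rw [hgx x hx, ← (hS x hx).sum_add_tsum_nat_add (N + 1), add_sub_cancel_left]
      exact enorm_tsum_le_tsum_enorm
    refine (h1.trans (qb_tsum Q _ ha')).trans (ENNReal.tsum_le_tsum fun n => ?_)
    exact mul_le_mul_left (pow_le_pow_right₀ hC (by omega)) _
end
end

section
/- Let X and Y be quasi-Banach function spaces over σ-finite measure spaces (R,μ) and (S,ν) respectively, and let T be a map sending μ-measurable functions on R to ν-measurable functions on S such that: (0) |T(a·f)| = |a|·|T(f)| ν-a.e. for all scalars a and all f; (1) there is c₁ > 0 with |T(f)| ≤ c₁·T(|f|) ν-a.e. for all f; (2) there is c₂ > 0 such that |f| ≤ |g| μ-a.e. implies |T(f)| ≤ c₂·|T(g)| ν-a.e. Then T is bounded from X to Y, i.e. there is a finite constant C_T > 0 with ‖T(f)‖_Y ≤ C_T·‖f‖_X for all f ∈ X, if and only if T(f) ∈ Y for every f ∈ X. -/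
open MeasureTheory Filter Set Topology
open scoped ENNReal NNReal

noncomputable section

lemma QBF_sum_le {α : Type*} [MeasurableSpace α] {μ : Measure α} (Q : QBFNorm μ) (N : ℕ) :
    ∀ (h : ℕ → α → ℝ≥0∞) (B : ℝ≥0∞), (∀ n, Measurable (h n)) →
      (∀ n, Q.ρ (h n) ≤ ((2 * (Q.C : ℝ≥0∞))⁻¹) ^ n * B) →
      Q.ρ (fun x => ∑ i ∈ Finset.range N, h i x) ≤ 2 * (Q.C : ℝ≥0∞) * B := by
  have hC0 : (Q.C : ℝ≥0∞) ≠ 0 := by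
    have := Q.one_le_C
    have h : Q.C ≠ 0 := (lt_of_lt_of_le one_pos this).ne'
    exact_mod_cast h
  have hD0 : 2 * (Q.C : ℝ≥0∞) ≠ 0 := mul_ne_zero two_ne_zero hC0
  have hDt : 2 * (Q.C : ℝ≥0∞) ≠ ⊤ := ENNReal.mul_ne_top (by simp) (by simp)
  induction N with
  | zero =>
    intro h B hm hB
    have : Q.ρ (fun _ => 0) = 0 := (Q.eq_zero_iff _ measurable_const).2 (Eventually.of_forall fun _ => rfl)
    simp [this]
  | succ N ih =>
    intro h B hm hB
    have h1 := ih (fun n => h (n + 1)) ((2 * (Q.C : ℝ≥0∞))⁻¹ * B) (fun n => hm _) (fun n => by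
      have := hB (n + 1)
      rwa [pow_succ, mul_assoc] at this)
    rw [← mul_assoc, ENNReal.mul_inv_cancel hD0 hDt, one_mul] at h1
    have h2 := hB 0
    simp only [pow_zero, one_mul] at h2
    simp only [Finset.sum_range_succ']
    refine (Q.triangle _ _ (Finset.measurable_fun_sum _ fun i _ => hm _) (hm 0)).trans ?_
    calc (Q.C : ℝ≥0∞) * (_ + _) ≤ Q.C * (B + B) := by gcongr
      _ = _ := by ring

lemma QBF_ae_lt_top {α : Type*} [MeasurableSpace α] {μ : Measure α} (Q : QBFNorm μ)
    (g : α → ℝ≥0∞) (hg : Measurable g) (hQ : Q.ρ g < ⊤) : ∀ᵐ x ∂μ, g x < ⊤ := by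
  set E : Set α := {x | g x = ⊤} with hE
  have hEm : MeasurableSet E := hg (measurableSet_singleton ⊤)
  have hi : Measurable (E.indicator fun _ => (1 : ℝ≥0∞)) := measurable_const.indicator hEm
  have key : ∀ n : ℕ, (n : ℝ≥0∞) * Q.ρ (E.indicator fun _ => 1) ≤ Q.ρ g := by
    intro n
    have := Q.smul_hom (n : ℝ≥0) _ hi
    simp only [ENNReal.coe_natCast] at this
    rw [← this]
    refine Q.mono _ _ (hi.const_mul _) hg (Eventually.of_forall fun x => ?_)
    by_cases hx : x ∈ E
    · have : g x = ⊤ := hx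
      simp [this]
    · simp [hx]
  have h0 : Q.ρ (E.indicator fun _ => 1) = 0 := by
    by_contra hne
    obtain ⟨n, hn⟩ := ENNReal.exists_nat_mul_gt hne hQ.ne
    exact absurd (key n) (not_le.2 hn)
  filter_upwards [(Q.eq_zero_iff _ hi).1 h0] with x hx
  rw [lt_top_iff_ne_top]
  intro hxt
  have : x ∈ E := hxt
  simp [this] at hx

/-- Let `X`, `Y` be quasi-Banach function spaces over σ-finite measure spaces
`(α, μ)`, `(β, ν)` and let `T` map measurable functions on `α` to measurable
functions on `β`, with (0) `|T(a·f)| = |a|·|T f|` ν-a.e., (1) `|T f| ≤ c₁·T(|f|)`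
ν-a.e., and (2) `|f| ≤ |g|` μ-a.e. implies `|T f| ≤ c₂·|T g|` ν-a.e. Then `T` is
bounded from `X` to `Y` if and only if `T f ∈ Y` for every `f ∈ X`. -/
theorem stmt_8 {α β : Type*} [MeasurableSpace α] [MeasurableSpace β]
    (μ : Measure α) (ν : Measure β) [SigmaFinite μ] [SigmaFinite ν]
    (Q : QBFNorm μ) (P : QBFNorm ν)
    (T : (α → ℝ) → β → ℝ)
    (hTmeas : ∀ f : α → ℝ, Measurable f → Measurable (T f))
    (h0 : ∀ (a : ℝ) (f : α → ℝ), Measurable f →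
      ∀ᵐ y ∂ν, |T (fun x => a * f x) y| = |a| * |T f y|)
    (c₁ : ℝ) (hc₁ : 0 < c₁)
    (h1 : ∀ f : α → ℝ, Measurable f → ∀ᵐ y ∂ν, |T f y| ≤ c₁ * T (fun x => |f x|) y)
    (c₂ : ℝ) (hc₂ : 0 < c₂)
    (h2 : ∀ f g : α → ℝ, Measurable f → Measurable g →
      (∀ᵐ x ∂μ, |f x| ≤ |g x|) → ∀ᵐ y ∂ν, |T f y| ≤ c₂ * |T g y|) :
    (∃ CT : ℝ≥0, 0 < CT ∧ ∀ f : α → ℝ, Measurable f → Xnorm Q f < ⊤ →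
        Xnorm P (T f) ≤ (CT : ℝ≥0∞) * Xnorm Q f)
    ↔ (∀ f : α → ℝ, Measurable f → Xnorm Q f < ⊤ → Xnorm P (T f) < ⊤) := by
  have nmβ : ∀ (f : β → ℝ), Measurable f →
      Measurable fun x => (‖f x‖₊ : ℝ≥0∞) := fun f hf => hf.nnnorm.coe_nnreal_ennreal
  -- homogeneity of `f ↦ ‖T f‖`
  have hscale : ∀ (a : ℝ≥0) (f : α → ℝ), Measurable f →
      Xnorm P (T fun x => (a : ℝ) * f x) = a * Xnorm P (T f) := by
    intro a f hf
    unfold Xnorm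
    rw [← P.smul_hom a _ (nmβ _ (hTmeas f hf))]
    refine P.congr_ae _ _ (nmβ _ (hTmeas _ (hf.const_mul _)))
      ((nmβ _ (hTmeas f hf)).const_mul _) ?_
    filter_upwards [h0 a f hf] with y hy
    rw [← ENNReal.coe_mul, ENNReal.coe_inj]
    apply NNReal.eq
    simpa using hy
  have hmono : ∀ f g : α → ℝ, Measurable f → Measurable g → (∀ᵐ x ∂μ, |f x| ≤ |g x|) →
      Xnorm P (T f) ≤ (c₂.toNNReal : ℝ≥0∞) * Xnorm P (T g) := by
    intro f g hf hg hfg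
    unfold Xnorm
    rw [← P.smul_hom _ _ (nmβ _ (hTmeas g hg))]
    refine P.mono _ _ (nmβ _ (hTmeas f hf)) ((nmβ _ (hTmeas g hg)).const_mul _) ?_
    filter_upwards [h2 f g hf hg hfg] with y hy
    rw [← ENNReal.coe_mul, ENNReal.coe_le_coe, ← NNReal.coe_le_coe]
    simpa [hc₂.le] using hy
  constructor
  · rintro ⟨CT, -, h⟩ f hf hfX
    exact (h f hf hfX).trans_lt (ENNReal.mul_lt_top (by simp) hfX)
  intro H
  by_contra hcon
  push Not at hcon
  have hC0 : 0 < Q.C := lt_of_lt_of_le one_pos Q.one_le_C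
  have hD : 0 < 2 * Q.C := by positivity
  have step : ∀ n : ℕ, ∃ g : α → ℝ, Measurable g ∧
      Xnorm Q g ≤ ((2 * (Q.C : ℝ≥0∞))⁻¹) ^ n * 1 ∧ (n : ℝ≥0∞) ≤ Xnorm P (T g) := by
    intro n
    obtain ⟨f, hf, hfX, hlt⟩ := hcon ((n + 1) * (2 * Q.C) ^ n) (by positivity)
    have hq0 : Xnorm Q f ≠ 0 := by
      intro hq
      have hz := (Q.eq_zero_iff _ (hf.nnnorm.coe_nnreal_ennreal)).1 hq
      have hle := hmono f (fun x => ((0 : ℝ≥0) : ℝ) * f x) hf (hf.const_mul _) (by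
        filter_upwards [hz] with x hx
        have : f x = 0 := by simpa using hx
        simp [this])
      rw [hscale 0 f hf] at hle
      simp only [ENNReal.coe_zero, zero_mul, mul_zero] at hle
      exact absurd (hlt.trans_le hle) (by simp)
    obtain ⟨q, hq⟩ := WithTop.ne_top_iff_exists.1 hfX.ne
    change (q : ℝ≥0∞) = _ at hq
    rw [← hq] at hq0 hlt
    have hq0' : q ≠ 0 := by simpa using hq0
    set a : ℝ≥0 := ((2 * Q.C)⁻¹) ^ n * q⁻¹ with ha
    refine ⟨fun x => (a : ℝ) * f x, hf.const_mul _, ?_, ?_⟩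
    · have : Xnorm Q (fun x => (a : ℝ) * f x) = a * Xnorm Q f := by
        unfold Xnorm
        rw [← Q.smul_hom a _ hf.nnnorm.coe_nnreal_ennreal]
        congr 1
        ext x
        simp [nnnorm_mul]
      rw [this, ← hq]
      have e : (2 * (Q.C : ℝ≥0∞))⁻¹ = (((2 * Q.C)⁻¹ : ℝ≥0) : ℝ≥0∞) := by
        rw [ENNReal.coe_inv hD.ne']; simp
      rw [e]
      have : a * q = ((2 * Q.C)⁻¹) ^ n * 1 := by
        rw [ha, mul_assoc, inv_mul_cancel₀ hq0']
      exact_mod_cast this.le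
    · rw [hscale a f hf]
      have e : a * (((n + 1) * (2 * Q.C) ^ n) * q) = n + 1 := by
        rw [ha, inv_pow]; field_simp
      calc (n : ℝ≥0∞) ≤ ((n + 1 : ℝ≥0) : ℝ≥0∞) := by simp
        _ = a * ((((n + 1) * (2 * Q.C) ^ n : ℝ≥0) : ℝ≥0∞) * q) := by
          rw [← ENNReal.coe_mul, ← ENNReal.coe_mul, e]
        _ ≤ _ := by gcongr
  choose g hgm hgX hgY using step
  set G : α → ℝ≥0∞ := fun x => ⨆ N, ∑ i ∈ Finset.range N, (‖g i x‖₊ : ℝ≥0∞) with hG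
  have hpm : ∀ N, Measurable fun x => ∑ i ∈ Finset.range N, (‖g i x‖₊ : ℝ≥0∞) := fun N =>
    Finset.measurable_fun_sum _ fun i _ => (hgm i).nnnorm.coe_nnreal_ennreal
  have hGm : Measurable G := Measurable.iSup hpm
  have hGQ : Q.ρ G < ⊤ := by
    rw [hG, Q.fatou _ hpm (Eventually.of_forall fun x => by
      intro m n hmn
      exact Finset.sum_le_sum_of_subset (Finset.range_mono hmn))]
    refine lt_of_le_of_lt (iSup_le fun N => QBF_sum_le Q N _ 1
      (fun i => (hgm i).nnnorm.coe_nnreal_ennreal) hgX) ?_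
    exact ENNReal.mul_lt_top (ENNReal.mul_lt_top (by simp) (by simp)) (by simp)
  have hfin := QBF_ae_lt_top Q G hGm hGQ
  have hFm : Measurable fun x => (G x).toReal := hGm.ennreal_toReal
  have hFX : Xnorm Q (fun x => (G x).toReal) < ⊤ := by
    unfold Xnorm
    rw [Q.congr_ae _ G hFm.nnnorm.coe_nnreal_ennreal hGm]
    · exact hGQ
    filter_upwards [hfin] with x hx
    change ‖(G x).toReal‖ₑ = G x
    rw [Real.enorm_eq_ofReal ENNReal.toReal_nonneg, ENNReal.ofReal_toReal hx.ne]
  have hFY := H _ hFm hFX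
  have hbd : ∀ n : ℕ, (n : ℝ≥0∞) ≤ (c₂.toNNReal : ℝ≥0∞) * Xnorm P (T fun x => (G x).toReal) := by
    intro n
    refine (hgY n).trans (hmono _ _ (hgm n) hFm ?_)
    filter_upwards [hfin] with x hx
    rw [abs_of_nonneg ENNReal.toReal_nonneg]
    have hle : (‖g n x‖₊ : ℝ≥0∞) ≤ G x :=
      le_trans (Finset.single_le_sum (f := fun i => (‖g i x‖₊ : ℝ≥0∞)) (fun _ _ => zero_le)
        (Finset.self_mem_range_succ n))
        (le_iSup (fun N => ∑ i ∈ Finset.range N, (‖g i x‖₊ : ℝ≥0∞)) (n + 1))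
    simpa using ENNReal.toReal_mono hx.ne hle
  obtain ⟨n, hn⟩ := ENNReal.exists_nat_gt
    (ENNReal.mul_lt_top (ENNReal.coe_lt_top (r := c₂.toNNReal)) hFY).ne
  exact absurd (hbd n) (not_le.2 hn)
end
end

section
/- Let X be a quasi-Banach function space over a σ-finite measure space (R,μ), and let ‖·‖_{X'} and X' be the associate functional and associate space of X. Then a μ-measurable function f belongs to X' if and only if ∫_R |f·g| dμ < ∞ for every g ∈ X. -/
open MeasureTheory Filter Set Topology
open scoped ENNReal NNReal

noncomputable section

/-- The associate functional `‖f‖_{X'} = sup_{g ∈ X} (∫ |f·g| dμ) / ‖g‖_X`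
(in `[0,∞]`, with the conventions `0/0 = 0` and `a/0 = ∞` for `a > 0`, which are
the conventions of `ℝ≥0∞` division). -/
def assocNorm {α : Type*} [MeasurableSpace α] {μ : Measure α} (Q : QBFNorm μ)
    (f : α → ℂ) : ℝ≥0∞ :=
  ⨆ (g : α → ℂ) (_ : Measurable g) (_ : Xnorm Q g < ⊤),
    (∫⁻ x, (‖f x‖₊ : ℝ≥0∞) * (‖g x‖₊ : ℝ≥0∞) ∂μ) / Xnorm Q g

theorem rho_sum_le {α : Type*} [MeasurableSpace α] {μ : Measure α} (Q : QBFNorm μ) (m : ℕ) :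
    ∀ (ε : ℝ≥0) (h : ℕ → α → ℝ≥0∞), (∀ n, Measurable (h n)) →
      (∀ n, Q.ρ (h n) ≤ ((ε * (2 * Q.C)⁻¹ ^ (n + 1) : ℝ≥0) : ℝ≥0∞)) →
      Q.ρ (fun x => ∑ k ∈ Finset.range m, h k x) ≤ ε := by
  induction m with
  | zero =>
    intro ε h _ _
    have : Q.ρ (fun x => ∑ k ∈ Finset.range 0, h k x) = 0 := by
      rw [Q.eq_zero_iff _ (by simp)]
      simp only [Finset.range_zero, Finset.sum_empty]
      exact Filter.EventuallyEq.rfl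
    rw [this]
    exact zero_le
  | succ m ih =>
    intro ε h hm hb
    have hC : Q.C ≠ 0 := (lt_of_lt_of_le one_pos Q.one_le_C).ne'
    have h1 := ih (ε * (2 * Q.C)⁻¹) (fun n => h (n + 1)) (fun n => hm _) (fun n => by
      refine (hb (n + 1)).trans (le_of_eq ?_)
      congr 1
      ring)
    have h2 := Q.triangle (fun x => ∑ k ∈ Finset.range m, h (k + 1) x) (h 0)
      (Finset.measurable_sum _ fun k _ => hm _) (hm 0)
    simp only [Finset.sum_range_succ']
    refine h2.trans ?_
    have h3 := hb 0
    simp only [zero_add, pow_one] at h3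
    refine (mul_le_mul_right (add_le_add h1 h3) _).trans (le_of_eq ?_)
    rw [← ENNReal.coe_add, ← ENNReal.coe_mul]
    congr 1
    field_simp
    ring

theorem rho_ae_lt_top {α : Type*} [MeasurableSpace α] {μ : Measure α} (Q : QBFNorm μ)
    (g : α → ℝ≥0∞) (hg : Measurable g) (hb : Q.ρ g < ⊤) : ∀ᵐ x ∂μ, g x ≠ ⊤ := by
  have hE : MeasurableSet {x | g x = ⊤} := hg (measurableSet_singleton ⊤)
  set e : α → ℝ≥0∞ := {x | g x = ⊤}.indicator (fun _ => 1) with he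
  have hem : Measurable e := measurable_const.indicator hE
  have key : ∀ n : ℕ, (n : ℝ≥0∞) * Q.ρ e ≤ Q.ρ g := by
    intro n
    have := Q.smul_hom (n : ℝ≥0) e hem
    simp only [ENNReal.coe_natCast] at this
    rw [← this]
    refine Q.mono _ _ (hem.const_mul _) hg (Eventually.of_forall fun x => ?_)
    by_cases hx : g x = ⊤
    · simp [hx]
    · simp [he, hx]
  have h0 : Q.ρ e = 0 := by
    by_contra hne
    obtain ⟨n, hn⟩ := ENNReal.exists_nat_mul_gt hne hb.ne
    exact absurd (key n) (not_le.mpr hn)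
  rw [Q.eq_zero_iff e hem] at h0
  filter_upwards [h0] with x hx hgx
  simp [he, hgx] at hx

theorem lint_zero {α : Type*} [MeasurableSpace α] {μ : Measure α} (Q : QBFNorm μ)
    (f g : α → ℂ) (hg : Measurable g) (h : Xnorm Q g = 0) :
    ∫⁻ x, (‖f x‖₊ : ℝ≥0∞) * (‖g x‖₊ : ℝ≥0∞) ∂μ = 0 := by
  have h' := (Q.eq_zero_iff _ (by fun_prop)).1 h
  rw [← lintegral_zero (μ := μ)]
  refine lintegral_congr_ae ?_
  filter_upwards [h'] with x hx
  simp only [Pi.zero_apply] at hx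
  simp only [hx, mul_zero]

/-- (Landau's resonance theorem.) Let `X` be a quasi-Banach function space over a
σ-finite measure space and `X'` its associate space. A measurable function `f`
belongs to `X'` if and only if `∫ |f·g| dμ < ∞` for every `g ∈ X`. -/
theorem stmt_10 {α : Type*} [MeasurableSpace α] (μ : Measure α) [SigmaFinite μ]
    (Q : QBFNorm μ) (f : α → ℂ) (hf : Measurable f) :
    assocNorm Q f < ⊤ ↔
      ∀ g : α → ℂ, Measurable g → Xnorm Q g < ⊤ →
        ∫⁻ x, (‖f x‖₊ : ℝ≥0∞) * (‖g x‖₊ : ℝ≥0∞) ∂μ < ⊤ := by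
  constructor
  · intro h g hg hgX
    by_cases h0 : Xnorm Q g = 0
    · rw [lint_zero Q f g hg h0]
      exact ENNReal.zero_lt_top
    · have h1 : (∫⁻ x, (‖f x‖₊ : ℝ≥0∞) * (‖g x‖₊ : ℝ≥0∞) ∂μ) / Xnorm Q g ≤ assocNorm Q f :=
        le_iSup₂_of_le g hg (le_iSup_of_le hgX le_rfl)
      rw [ENNReal.div_le_iff h0 hgX.ne] at h1
      exact h1.trans_lt (ENNReal.mul_lt_top h hgX)
  · intro H
    by_contra hcon
    have htop : assocNorm Q f = ⊤ := by simpa using hcon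
    have hC : Q.C ≠ 0 := (lt_of_lt_of_le one_pos Q.one_le_C).ne'
    have hex : ∀ K : ℝ≥0, ∃ g : α → ℂ, Measurable g ∧ Xnorm Q g < ⊤ ∧
        (K : ℝ≥0∞) < (∫⁻ x, (‖f x‖₊ : ℝ≥0∞) * (‖g x‖₊ : ℝ≥0∞) ∂μ) / Xnorm Q g := by
      intro K
      have hK : (K : ℝ≥0∞) < assocNorm Q f := by rw [htop]; exact ENNReal.coe_lt_top
      unfold assocNorm at hK
      simp only [lt_iSup_iff] at hK
      obtain ⟨g, h1, h2, h3⟩ := hK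
      exact ⟨g, h1, h2, h3⟩
    choose g hgm hgX hgK using fun n : ℕ => hex (n * (2 * Q.C) ^ (n + 1))
    have hN0 : ∀ n, Xnorm Q (g n) ≠ 0 := by
      intro n h0
      have := hgK n
      rw [lint_zero Q f _ (hgm n) h0] at this
      simp at this
    set N : ℕ → ℝ≥0 := fun n => (Xnorm Q (g n)).toNNReal with hN
    have hNX : ∀ n, (N n : ℝ≥0∞) = Xnorm Q (g n) := fun n => ENNReal.coe_toNNReal (hgX n).ne
    have hNne : ∀ n, N n ≠ 0 := by
      intro n h
      apply hN0 n
      rw [← hNX n, h, ENNReal.coe_zero]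
    set c : ℕ → ℝ≥0 := fun n => (N n)⁻¹ * (2 * Q.C)⁻¹ ^ (n + 1) with hc
    set h : ℕ → α → ℝ≥0∞ := fun n x => (c n : ℝ≥0∞) * (‖g n x‖₊ : ℝ≥0∞) with hh
    have hhm : ∀ n, Measurable (h n) := fun n => by
      have := hgm n
      simp only [hh]
      fun_prop
    have hρ : ∀ n, Q.ρ (h n) ≤ ((1 * (2 * Q.C)⁻¹ ^ (n + 1) : ℝ≥0) : ℝ≥0∞) := by
      intro n
      have h1 := Q.smul_hom (c n) (fun x => (‖g n x‖₊ : ℝ≥0∞)) (by have := hgm n; fun_prop)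
      simp only [hh]
      rw [h1]
      change (c n : ℝ≥0∞) * Xnorm Q (g n) ≤ _
      rw [← hNX n, ← ENNReal.coe_mul]
      refine le_of_eq ?_
      congr 1
      have := hNne n
      simp only [hc]
      field_simp
    set G : α → ℝ≥0∞ := fun x => ⨆ m, ∑ k ∈ Finset.range m, h k x with hG
    have hSm : ∀ m, Measurable (fun x => ∑ k ∈ Finset.range m, h k x) := fun m =>
      Finset.measurable_sum _ fun k _ => hhm k
    have hGm : Measurable G := Measurable.iSup hSm
    have hGρ : Q.ρ G ≤ 1 := by
      rw [hG, Q.fatou (fun m x => ∑ k ∈ Finset.range m, h k x) hSm]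
      · exact iSup_le fun m => by simpa using rho_sum_le Q m 1 h hhm hρ
      · exact Eventually.of_forall fun x m n hmn =>
          Finset.sum_le_sum_of_subset (Finset.range_mono hmn)
    have hGtop : Q.ρ G < ⊤ := hGρ.trans_lt ENNReal.one_lt_top
    have hfin := rho_ae_lt_top Q G hGm hGtop
    have hGle : ∀ n x, h n x ≤ G x := fun n x =>
      le_iSup_of_le (n + 1) (Finset.single_le_sum (f := fun k => h k x)
        (fun _ _ => zero_le) (Finset.self_mem_range_succ n))
    have hnorm : ∀ᵐ x ∂μ, (‖((G x).toReal : ℂ)‖₊ : ℝ≥0∞) = G x := by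
      filter_upwards [hfin] with x hx
      rw [Complex.nnnorm_real, Real.nnnorm_of_nonneg ENNReal.toReal_nonneg]
      exact ENNReal.coe_toNNReal hx
    have hm' : Measurable fun x => ((G x).toReal : ℂ) := by fun_prop
    have hlt := H (fun x => ((G x).toReal : ℂ)) hm' (by
      unfold Xnorm
      rw [Q.congr_ae _ G (by fun_prop) hGm hnorm]
      exact hGtop)
    have hge : ∀ n : ℕ, (n : ℝ≥0∞) ≤
        ∫⁻ x, (‖f x‖₊ : ℝ≥0∞) * (‖((G x).toReal : ℂ)‖₊ : ℝ≥0∞) ∂μ := by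
      intro n
      have h1 : (c n : ℝ≥0∞) * ∫⁻ x, (‖f x‖₊ : ℝ≥0∞) * (‖g n x‖₊ : ℝ≥0∞) ∂μ ≤
          ∫⁻ x, (‖f x‖₊ : ℝ≥0∞) * (‖((G x).toReal : ℂ)‖₊ : ℝ≥0∞) ∂μ := by
        rw [← lintegral_const_mul' _ _ ENNReal.coe_ne_top]
        refine lintegral_mono_ae ?_
        filter_upwards [hnorm] with x hx
        rw [hx, mul_left_comm]
        exact mul_le_mul_right (hGle n x) _
      refine le_trans ?_ h1
      have h2 := (hgK n).le
      rw [ENNReal.le_div_iff_mul_le (Or.inl (hN0 n)) (Or.inl (hgX n).ne), ← hNX n,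
        ← ENNReal.coe_mul] at h2
      refine le_trans (le_of_eq ?_) (mul_le_mul_right h2 _)
      rw [← ENNReal.coe_mul, ← ENNReal.coe_natCast]
      congr 1
      have := hNne n
      simp only [hc]
      rw [inv_pow]
      field_simp
    obtain ⟨n, hn⟩ := ENNReal.exists_nat_gt hlt.ne
    exact absurd (hge n) (not_le.mpr hn)
end
end

section
/- Let X be a quasi-Banach function space over a σ-finite measure space (R,μ). Suppose that for every constant K ∈ (0,∞) there exists a nonnegative function f ∈ X with ∫_R f dμ > K·‖f‖_X. Then there exists a nonnegative function f₀ ∈ X with ∫_R f₀ dμ = ∞. -/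
open MeasureTheory Filter Set Topology
open scoped ENNReal NNReal

noncomputable section

theorem QBFNorm.sum_bound {α : Type*} [MeasurableSpace α] {μ : Measure α} (Q : QBFNorm μ)
    (g : ℕ → α → ℝ≥0∞) (hg : ∀ n, Measurable (g n))
    (hb : ∀ n, Q.ρ (g n) ≤ (((2 * Q.C)⁻¹ ^ n : ℝ≥0) : ℝ≥0∞)) (n : ℕ) : ∀ m,
    Q.ρ (fun x => ∑ i ∈ Finset.range n, g (m + i) x)
      ≤ ((2 * Q.C * (2 * Q.C)⁻¹ ^ m : ℝ≥0) : ℝ≥0∞) := by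
  have hC : Q.C ≠ 0 := (lt_of_lt_of_le one_pos Q.one_le_C).ne'
  induction n with
  | zero =>
    intro m
    have : Q.ρ (fun x => ∑ i ∈ Finset.range 0, g (m + i) x) = 0 := by
      rw [Q.eq_zero_iff _ (by simp)]
      simp only [Finset.range_zero, Finset.sum_empty]
      exact Filter.EventuallyEq.rfl
    rw [this]; exact zero_le
  | succ n ih =>
    intro m
    have h1 : (fun x => ∑ i ∈ Finset.range (n + 1), g (m + i) x)
        = fun x => g m x + ∑ i ∈ Finset.range n, g ((m + 1) + i) x := by
      funext x
      rw [Finset.sum_range_succ', add_comm]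
      congr 1
      refine Finset.sum_congr rfl fun i _ => ?_
      rw [show m + (i + 1) = m + 1 + i by ring]
    rw [h1]
    refine (Q.triangle _ _ (hg m)
      (Finset.measurable_fun_sum _ fun i _ => hg _)).trans ?_
    refine (mul_le_mul_right (add_le_add (hb m) (ih (m + 1))) _).trans ?_
    rw [← ENNReal.coe_add, ← ENNReal.coe_mul, ENNReal.coe_le_coe]
    apply le_of_eq
    rw [pow_succ]
    field_simp
    ring

/-- Let `X` be a quasi-Banach function space over a σ-finite measure space `(α, μ)`.
If for every `K ∈ (0,∞)` there is a nonnegative `f ∈ X` with `∫ f dμ > K·‖f‖_X`,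
then there is a nonnegative `f₀ ∈ X` with `∫ f₀ dμ = ∞`. -/
theorem stmt_11 {α : Type*} [MeasurableSpace α] (μ : Measure α) [SigmaFinite μ]
    (Q : QBFNorm μ)
    (hyp : ∀ K : ℝ≥0∞, 0 < K → K < ⊤ → ∃ f : α → ℝ≥0∞, Measurable f ∧
      Q.ρ f < ⊤ ∧ K * Q.ρ f < ∫⁻ x, f x ∂μ) :
    ∃ f₀ : α → ℝ≥0∞, Measurable f₀ ∧ Q.ρ f₀ < ⊤ ∧ ∫⁻ x, f₀ x ∂μ = ⊤ := by
  have hC : Q.C ≠ 0 := (lt_of_lt_of_le one_pos Q.one_le_C).ne'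
  have hD : (2 * Q.C) ≠ 0 := mul_ne_zero two_ne_zero hC
  have key : ∀ n : ℕ, ∃ g : α → ℝ≥0∞, Measurable g ∧
      Q.ρ g ≤ (((2 * Q.C)⁻¹ ^ n : ℝ≥0) : ℝ≥0∞) ∧ 1 ≤ ∫⁻ x, g x ∂μ := by
    intro n
    obtain ⟨f, hf, hfin, hK⟩ := hyp (((2 * Q.C) ^ n : ℝ≥0) : ℝ≥0∞)
      (by exact_mod_cast pow_pos (pos_iff_ne_zero.2 hD) n) ENNReal.coe_lt_top
    obtain ⟨r, hr⟩ : ∃ r : ℝ≥0, (r : ℝ≥0∞) = Q.ρ f := ⟨_, ENNReal.coe_toNNReal hfin.ne⟩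
    have hr0 : r ≠ 0 := by
      rintro rfl
      have h0 : f =ᵐ[μ] 0 := (Q.eq_zero_iff f hf).1 (by rw [← hr]; simp)
      rw [lintegral_congr_ae h0] at hK
      simp at hK
    refine ⟨fun x => (((2 * Q.C)⁻¹ ^ n * r⁻¹ : ℝ≥0) : ℝ≥0∞) * f x, hf.const_mul _, ?_, ?_⟩
    · rw [Q.smul_hom _ _ hf, ← hr, ← ENNReal.coe_mul, mul_assoc, inv_mul_cancel₀ hr0, mul_one]
    · rw [lintegral_const_mul _ hf]
      refine le_trans ?_ (mul_le_mul_right hK.le _)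
      rw [← hr, ← ENNReal.coe_mul, ← ENNReal.coe_mul]
      apply le_of_eq
      rw [← ENNReal.coe_one, ENNReal.coe_inj]
      field_simp
      rw [← mul_pow, one_div, inv_mul_cancel₀ hD, one_pow]
  choose g hg hb hi using key
  have hS : ∀ n, Measurable (fun x => ∑ i ∈ Finset.range n, g i x) := fun n =>
    Finset.measurable_fun_sum _ fun i _ => hg i
  refine ⟨fun x => ⨆ n, ∑ i ∈ Finset.range n, g i x, Measurable.iSup hS, ?_, ?_⟩
  · rw [Q.fatou _ hS (Filter.Eventually.of_forall fun x a b hab =>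
      Finset.sum_le_sum_of_subset (Finset.range_mono hab))]
    refine lt_of_le_of_lt (iSup_le fun n => ?_) (ENNReal.coe_lt_top (r := 2 * Q.C))
    simpa using Q.sum_bound g hg hb n 0
  · have : ∀ x, (⨆ n, ∑ i ∈ Finset.range n, g i x) = ∑' i, g i x := fun x =>
      (ENNReal.tsum_eq_iSup_nat).symm
    simp only [this]
    rw [lintegral_tsum fun i => (hg i).aemeasurable, eq_top_iff,
      ← ENNReal.tsum_const_eq_top_of_ne_zero (α := ℕ) (c := 1) one_ne_zero]
    exact ENNReal.tsum_le_tsum hi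
end
end

section
/- Let X be a quasi-Banach function space over (ℝⁿ, λⁿ). Suppose that for every compact set K ⊆ ℝⁿ the function χ_K has absolutely continuous quasinorm. Then for every f ∈ X that has absolutely continuous quasinorm and every ε > 0 there is a function s ∈ 𝒮 such that ‖f − s‖_X < ε. -/
open MeasureTheory Filter Set Topology
open scoped ENNReal NNReal

noncomputable section

/-- `f ∈ X` has absolutely continuous quasinorm: `‖f·χ_{E k}‖_X → 0` whenever
`(E k)` is a sequence of measurable sets with `χ_{E k} → 0` a.e. -/
def HasACNorm {α : Type*} [MeasurableSpace α] {μ : Measure α} (Q : QBFNorm μ)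
    (f : α → ℂ) : Prop :=
  ∀ E : ℕ → Set α, (∀ k, MeasurableSet (E k)) →
    (∀ᵐ x ∂μ, Tendsto (fun k => (E k).indicator (fun _ => (1 : ℝ)) x) atTop (nhds 0)) →
    Tendsto (fun k => Xnorm Q ((E k).indicator f)) atTop (nhds 0)

/-- The open dyadic cube `Q_{k,a} = ∏_{i} (a i / 2^k, (a i + 1) / 2^k)` in `ℝⁿ`. -/
def dyadicCube (n : ℕ) (k : ℤ) (a : Fin n → ℤ) : Set (Fin n → ℝ) :=
  {x | ∀ i : Fin n, (a i : ℝ) / 2 ^ k < x i ∧ x i < ((a i : ℝ) + 1) / 2 ^ k}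

/-- Membership in the countable family `𝒮` of simple functions
`∑ i a_i · χ_{Q_i}` with `Q_i` dyadic cubes and `a_i ∈ ℂ` with rational real and
imaginary parts. -/
def memS (n : ℕ) (s : (Fin n → ℝ) → ℂ) : Prop :=
  ∃ (m : ℕ) (k : Fin m → ℤ) (a : Fin m → Fin n → ℤ) (c : Fin m → ℚ × ℚ),
    s = fun x => ∑ i : Fin m,
      (((c i).1 : ℂ) + ((c i).2 : ℂ) * Complex.I) *
        (dyadicCube n (k i) (a i)).indicator (fun _ => (1 : ℂ)) x

section helpers

variable {n : ℕ} (Q : QBFNorm (volume : Measure (Fin n → ℝ)))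

/-- `g` can be approximated by elements of `𝒮`. -/
def Approx (g : (Fin n → ℝ) → ℂ) : Prop :=
  ∀ ε : ℝ≥0∞, 0 < ε → ∃ s : (Fin n → ℝ) → ℂ, memS n s ∧ Xnorm Q (g - s) < ε

theorem isOpen_dyadicCube (k : ℤ) (a : Fin n → ℤ) : IsOpen (dyadicCube n k a) := by
  have : dyadicCube n k a = Set.pi univ
      (fun i => Ioo ((a i : ℝ) / 2 ^ k) (((a i : ℝ) + 1) / 2 ^ k)) := by
    ext x; simp [dyadicCube]
  rw [this]
  exact isOpen_set_pi finite_univ fun _ _ => isOpen_Ioo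

theorem memS_of_fintype {ι : Type*} [Fintype ι] (k : ι → ℤ) (a : ι → Fin n → ℤ)
    (c : ι → ℚ × ℚ) :
    memS n (fun x => ∑ i, (((c i).1 : ℂ) + ((c i).2 : ℂ) * Complex.I) *
        (dyadicCube n (k i) (a i)).indicator (fun _ => (1 : ℂ)) x) := by
  let e := (Fintype.equivFin ι).symm
  refine ⟨Fintype.card ι, k ∘ e, a ∘ e, c ∘ e, ?_⟩
  funext x
  exact (Equiv.sum_comp e _).symm

theorem memS.measurable {s : (Fin n → ℝ) → ℂ} (hs : memS n s) : Measurable s := by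
  obtain ⟨m, k, a, c, rfl⟩ := hs
  refine Finset.measurable_fun_sum _ fun i _ => ?_
  exact measurable_const.mul
    (measurable_const.indicator (isOpen_dyadicCube _ _).measurableSet)

theorem memS.add {s t : (Fin n → ℝ) → ℂ} (hs : memS n s) (ht : memS n t) :
    memS n (s + t) := by
  obtain ⟨m, k, a, c, rfl⟩ := hs
  obtain ⟨m', k', a', c', rfl⟩ := ht
  have := memS_of_fintype (Sum.elim k k') (Sum.elim a a') (Sum.elim c c')
  simp only [Fintype.sum_sum_type, Sum.elim_inl, Sum.elim_inr] at this
  exact this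

theorem memS.smul {s : (Fin n → ℝ) → ℂ} (hs : memS n s) (p q : ℚ) :
    memS n (fun x => ((p : ℂ) + (q : ℂ) * Complex.I) * s x) := by
  obtain ⟨m, k, a, c, rfl⟩ := hs
  refine ⟨m, k, a, fun i => (p * (c i).1 - q * (c i).2, p * (c i).2 + q * (c i).1), ?_⟩
  funext x
  rw [Finset.mul_sum]
  refine Finset.sum_congr rfl fun i _ => ?_
  push_cast
  rw [← mul_assoc]
  congr 1
  linear_combination (q : ℂ) * (c i).2 * Complex.I_mul_I

theorem memS_zero : memS n (0 : (Fin n → ℝ) → ℂ) :=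
  ⟨0, Fin.elim0, Fin.elim0, Fin.elim0, by funext x; simp⟩

theorem exists_split (ε : ℝ≥0∞) (hε : 0 < ε) :
    ∃ η : ℝ≥0∞, 0 < η ∧ ∀ a b, a < η → b < η → (Q.C : ℝ≥0∞) * (a + b) < ε := by
  have ht : 0 < ε / (Q.C : ℝ≥0∞) := ENNReal.div_pos hε.ne' ENNReal.coe_ne_top
  refine ⟨ε / (Q.C : ℝ≥0∞) / 2, ENNReal.half_pos ht.ne', fun a b ha hb => ?_⟩
  have := ENNReal.add_lt_add ha hb
  rw [ENNReal.add_halves] at this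
  exact ENNReal.mul_lt_of_lt_div' this

theorem Xnorm_mono {f g : (Fin n → ℝ) → ℂ} (hf : Measurable f) (hg : Measurable g)
    (h : ∀ x, ‖f x‖ ≤ ‖g x‖) : Xnorm Q f ≤ Xnorm Q g := by
  refine Q.mono _ _ (by fun_prop) (by fun_prop) (Eventually.of_forall fun x => ?_)
  exact ENNReal.coe_le_coe.2 (h x)

theorem Xnorm_add_le {f g h : (Fin n → ℝ) → ℂ} (hh : Measurable h) (hf : Measurable f)
    (hg : Measurable g) (hle : ∀ x, ‖h x‖ ≤ ‖f x‖ + ‖g x‖) :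
    Xnorm Q h ≤ Q.C * (Xnorm Q f + Xnorm Q g) := by
  refine le_trans ?_ (Q.triangle _ _ (by fun_prop) (by fun_prop))
  refine Q.mono _ _ (by fun_prop) (by fun_prop) (Eventually.of_forall fun x => ?_)
  exact_mod_cast hle x

theorem Xnorm_smul (c : ℂ) {f : (Fin n → ℝ) → ℂ} (hf : Measurable f) :
    Xnorm Q (fun x => c * f x) = ‖c‖₊ * Xnorm Q f := by
  unfold Xnorm
  rw [← Q.smul_hom _ _ (by fun_prop)]
  simp

theorem Approx.of_close {f : (Fin n → ℝ) → ℂ} (hf : Measurable f)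
    (h : ∀ ε : ℝ≥0∞, 0 < ε → ∃ g, Measurable g ∧ Approx Q g ∧ Xnorm Q (f - g) < ε) :
    Approx Q f := by
  intro ε hε
  obtain ⟨η, hη, H⟩ := exists_split Q ε hε
  obtain ⟨g, hg, hga, hfg⟩ := h η hη
  obtain ⟨s, hs, hgs⟩ := hga η hη
  refine ⟨s, hs, lt_of_le_of_lt ?_ (H _ _ hfg hgs)⟩
  have hsm := hs.measurable
  refine Xnorm_add_le Q (by fun_prop) (by fun_prop) (by fun_prop) fun x => ?_
  simpa using norm_sub_le_norm_sub_add_norm_sub (f x) (g x) (s x)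

theorem Approx.add {f g : (Fin n → ℝ) → ℂ} (hf : Measurable f) (hg : Measurable g)
    (haf : Approx Q f) (hag : Approx Q g) : Approx Q (f + g) := by
  intro ε hε
  obtain ⟨η, hη, H⟩ := exists_split Q ε hε
  obtain ⟨s, hs, hfs⟩ := haf η hη
  obtain ⟨t, ht, hgt⟩ := hag η hη
  refine ⟨s + t, hs.add ht, lt_of_le_of_lt ?_ (H _ _ hfs hgt)⟩
  have hsm := hs.measurable
  have htm := ht.measurable
  refine Xnorm_add_le Q (by fun_prop) (by fun_prop) (by fun_prop) fun x => ?_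
  have : f x + g x - (s x + t x) = (f x - s x) + (g x - t x) := by ring
  simpa [this] using norm_add_le (f x - s x) (g x - t x)

theorem exists_small_mul_lt (r : ℝ≥0∞) (hr : r < ⊤) (ε : ℝ≥0∞) (hε : 0 < ε) :
    ∃ δ : ℝ≥0, 0 < δ ∧ (δ : ℝ≥0∞) * r < ε := by
  obtain ⟨δ, h1, h2⟩ := ENNReal.exists_nnreal_pos_mul_lt hr.ne hε.ne'
  exact ⟨δ, h1, h2⟩

theorem Approx.smul_rat {f : (Fin n → ℝ) → ℂ} (hf : Measurable f)
    (haf : Approx Q f) (p q : ℚ) :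
    Approx Q (fun x => ((p : ℂ) + (q : ℂ) * Complex.I) * f x) := by
  intro ε hε
  set c : ℂ := (p : ℂ) + (q : ℂ) * Complex.I with hc
  have : 0 < ε / (‖c‖₊ : ℝ≥0∞) := ENNReal.div_pos hε.ne' ENNReal.coe_ne_top
  obtain ⟨s, hs, hfs⟩ := haf _ this
  refine ⟨_, hs.smul p q, ?_⟩
  have hsm := hs.measurable
  have h2 := Xnorm_smul Q c (f := f - s) (by fun_prop)
  have h3 : (fun x => c * f x) - (fun x => c * s x) = fun x => c * (f - s) x := by
    funext x; simp [mul_sub]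
  rw [h3, h2]
  exact ENNReal.mul_lt_of_lt_div' hfs

theorem exists_crat_near (c : ℂ) (δ : ℝ≥0) (hδ : 0 < δ) :
    ∃ p q : ℚ, ‖c - ((p : ℂ) + (q : ℂ) * Complex.I)‖ ≤ δ := by
  have h : (0 : ℝ) < δ / 2 := by positivity
  obtain ⟨p, hp⟩ := exists_rat_near c.re h
  obtain ⟨q, hq⟩ := exists_rat_near c.im h
  refine ⟨p, q, (Complex.norm_le_abs_re_add_abs_im _).trans ?_⟩
  simp
  linarith

theorem Approx.smul {f : (Fin n → ℝ) → ℂ} (hf : Measurable f) (hfX : Xnorm Q f < ⊤)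
    (haf : Approx Q f) (c : ℂ) : Approx Q (fun x => c * f x) := by
  refine Approx.of_close Q (by fun_prop) fun ε hε => ?_
  obtain ⟨δ, hδ, hlt⟩ := exists_small_mul_lt _ hfX ε hε
  obtain ⟨p, q, hpq⟩ := exists_crat_near c δ hδ
  refine ⟨_, by fun_prop, haf.smul_rat Q hf p q, lt_of_le_of_lt ?_ hlt⟩
  have h3 : (fun x => c * f x) - (fun x => ((p : ℂ) + (q : ℂ) * Complex.I) * f x)
      = fun x => (c - ((p : ℂ) + (q : ℂ) * Complex.I)) * f x := by
    funext x; simp [sub_mul]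
  rw [h3, Xnorm_smul Q _ hf]
  gcongr
  exact hpq

theorem HasACNorm.tendsto' {f : (Fin n → ℝ) → ℂ} (h : HasACNorm Q f)
    (E : ℕ → Set (Fin n → ℝ)) (hE : ∀ k, MeasurableSet (E k))
    (h0 : ∀ᵐ x, ∀ᶠ j in atTop, x ∉ E j) :
    Tendsto (fun k => Xnorm Q ((E k).indicator f)) atTop (nhds 0) := by
  refine h E hE ?_
  filter_upwards [h0] with x hx
  refine tendsto_const_nhds.congr' ?_
  filter_upwards [hx] with j hj
  simp [hj]

/-- The indicator of a set as a complex function. -/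
abbrev chi (A : Set (Fin n → ℝ)) : (Fin n → ℝ) → ℂ := A.indicator fun _ => 1

theorem chi_diff {A B : Set (Fin n → ℝ)} (h : B ⊆ A) : chi (A \ B) = chi A - chi B := by
  funext x
  by_cases hB : x ∈ B
  · simp [chi, hB, h hB]
  · by_cases hA : x ∈ A <;> simp [chi, hB, hA]

theorem chi_union {A B : Set (Fin n → ℝ)} (h : Disjoint A B) :
    chi (A ∪ B) = chi A + chi B := by
  funext x
  by_cases hB : x ∈ B
  · have hA : x ∉ A := fun hA => Set.disjoint_left.1 h hA hB
    simp [chi, hB, hA]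
  · by_cases hA : x ∈ A <;> simp [chi, hB, hA]

theorem chi_biUnion {ι : Type*} (T : Finset ι) (A : ι → Set (Fin n → ℝ))
    (h : ∀ a b, a ≠ b → Disjoint (A a) (A b)) (x : Fin n → ℝ) :
    chi (⋃ a ∈ T, A a) x = ∑ a ∈ T, chi (A a) x := by
  classical
  induction T using Finset.induction_on with
  | empty => simp [chi]
  | insert a T ha ih =>
    rw [Finset.sum_insert ha, ← ih, Finset.set_biUnion_insert, chi_union]
    · rfl
    · rw [Set.disjoint_iUnion₂_right]
      intro b hb
      exact h _ _ fun hab => ha (hab ▸ hb)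

theorem measurable_chi {A : Set (Fin n → ℝ)} (hA : MeasurableSet A) : Measurable (chi A) :=
  measurable_const.indicator hA

/-- The hypothesis on compact sets. -/
def CompactAC : Prop := ∀ K : Set (Fin n → ℝ), IsCompact K → HasACNorm Q (chi K)

variable {Q}

theorem CompactAC.tendsto (hQ : CompactAC Q) {K : Set (Fin n → ℝ)} (hK : IsCompact K)
    (E : ℕ → Set (Fin n → ℝ)) (hE : ∀ k, MeasurableSet (E k)) (hEK : ∀ k, E k ⊆ K)
    (h0 : ∀ᵐ x, ∀ᶠ j in atTop, x ∉ E j) :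
    Tendsto (fun k => Xnorm Q (chi (E k))) atTop (nhds 0) := by
  have := (hQ K hK).tendsto' Q E hE h0
  refine this.congr fun k => ?_
  rw [chi, chi, Set.indicator_indicator, Set.inter_eq_left.2 (hEK k)]

theorem ae_not_dyadic : ∀ᵐ x : Fin n → ℝ, ∀ (i : Fin n) (j : ℕ) (m : ℤ),
    (2 : ℝ) ^ j * x i ≠ m := by
  rw [ae_all_iff]; intro i
  rw [ae_all_iff]; intro j
  rw [ae_all_iff]; intro m
  have := Measure.ae_eval_ne (fun _ : Fin n => (volume : Measure ℝ)) i ((m : ℝ) / 2 ^ j)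
  rw [← volume_pi] at this
  filter_upwards [this] with x hx h
  apply hx
  rw [eq_div_iff (by positivity), mul_comm, h]

theorem mem_dyadicCube_iff (j : ℕ) (a : Fin n → ℤ) (x : Fin n → ℝ) :
    x ∈ dyadicCube n (j : ℤ) a ↔ ∀ i, (a i : ℝ) < 2 ^ j * x i ∧ 2 ^ j * x i < a i + 1 := by
  simp only [dyadicCube, mem_ofPred_eq, zpow_natCast]
  refine forall_congr' fun i => ?_
  rw [div_lt_iff₀ (by positivity), lt_div_iff₀ (by positivity), mul_comm]

theorem floor_of_mem {j : ℕ} {a : Fin n → ℤ} {x : Fin n → ℝ}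
    (h : x ∈ dyadicCube n (j : ℤ) a) : a = fun i => ⌊2 ^ j * x i⌋ := by
  rw [mem_dyadicCube_iff] at h
  funext i
  exact (Int.floor_eq_iff.2 ⟨(h i).1.le, (h i).2⟩).symm

theorem dyadicCube_disjoint (j : ℕ) {a b : Fin n → ℤ} (hab : a ≠ b) :
    Disjoint (dyadicCube n (j : ℤ) a) (dyadicCube n (j : ℤ) b) := by
  rw [Set.disjoint_left]
  intro x hx hy
  exact hab ((floor_of_mem hx).trans (floor_of_mem hy).symm)

theorem eventually_cube_subset {V : Set (Fin n → ℝ)} (hV : IsOpen V) {x : Fin n → ℝ}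
    (hx : x ∈ V) : ∀ᶠ j : ℕ in atTop, ∀ a, x ∈ dyadicCube n (j : ℤ) a →
      dyadicCube n (j : ℤ) a ⊆ V := by
  obtain ⟨r, hr, hball⟩ := Metric.isOpen_iff.1 hV x hx
  have ht : Tendsto (fun j : ℕ => ((1 : ℝ) / 2) ^ j) atTop (nhds 0) :=
    tendsto_pow_atTop_nhds_zero_of_lt_one (by norm_num) (by norm_num)
  filter_upwards [ht.eventually_lt_const hr] with j hj a hxa y hya
  apply hball
  rw [Metric.mem_ball]
  refine lt_of_le_of_lt ((dist_pi_le_iff (by positivity)).2 fun i => ?_) hj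
  rw [mem_dyadicCube_iff] at hxa hya
  have h1 := hxa i
  have h2 := hya i
  rw [Real.dist_eq, one_div, inv_pow, ← one_div, le_div_iff₀ (by positivity),
    ← abs_of_pos (show (0 : ℝ) < 2 ^ j by positivity), ← abs_mul, abs_le]
  constructor <;> nlinarith

theorem approx_chi_open (hQ : CompactAC Q) {V : Set (Fin n → ℝ)} (hV : IsOpen V) (N : ℕ)
    (hVN : V ⊆ Metric.closedBall 0 N) : Approx Q (chi V) := by
  classical
  let T : ℕ → Finset (Fin n → ℤ) := fun j =>
    (Fintype.piFinset fun _ : Fin n => Finset.Icc (-((N : ℤ) * 2 ^ j)) ((N : ℤ) * 2 ^ j)).filter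
      fun a => dyadicCube n (j : ℤ) a ⊆ V
  let W : ℕ → Set (Fin n → ℝ) := fun j => ⋃ a ∈ T j, dyadicCube n (j : ℤ) a
  have hWV : ∀ j, W j ⊆ V := fun j => by
    refine iUnion₂_subset fun a ha => (Finset.mem_filter.1 ha).2
  have hWm : ∀ j, MeasurableSet (W j) := fun j =>
    Finset.measurableSet_biUnion _ fun a _ => (isOpen_dyadicCube _ _).measurableSet
  have hWS : ∀ j, memS n (chi (W j)) := fun j => by
    have := memS_of_fintype (ι := T j) (fun _ => (j : ℤ)) (fun a => a.1) (fun _ => (1, 0))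
    convert this using 1
    funext x
    rw [chi_biUnion _ _ fun a b hab => dyadicCube_disjoint j hab, ← Finset.sum_coe_sort]
    simp [chi]
  have ht := hQ.tendsto (isCompact_closedBall (0 : Fin n → ℝ) (N : ℝ)) (fun j => V \ W j)
    (fun j => hV.measurableSet.diff (hWm j)) (fun j => sdiff_subset.trans hVN) (by
      filter_upwards [ae_not_dyadic (n := n)] with x hx
      by_cases hxV : x ∈ V
      · filter_upwards [eventually_cube_subset hV hxV] with j hj
        have hmem : x ∈ dyadicCube n (j : ℤ) (fun i => ⌊2 ^ j * x i⌋) := by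
          rw [mem_dyadicCube_iff]
          intro i
          exact ⟨lt_of_le_of_ne (Int.floor_le _) (hx i j _).symm, Int.lt_floor_add_one _⟩
        intro h
        apply h.2
        refine mem_iUnion₂.2 ⟨_, Finset.mem_filter.2 ⟨?_, hj _ hmem⟩, hmem⟩
        rw [Fintype.mem_piFinset]
        intro i
        have hb : |x i| ≤ N := by
          have h1 := hVN hxV
          rw [mem_closedBall_zero_iff] at h1
          exact (norm_le_pi_norm x i).trans h1
        have hp : (0 : ℝ) < 2 ^ j := by positivity
        rw [abs_le] at hb
        rw [Finset.mem_Icc]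
        constructor
        · rw [Int.le_floor]; push_cast; nlinarith
        · have : ((⌊2 ^ j * x i⌋ : ℤ) : ℝ) ≤ N * 2 ^ j := by
            refine (Int.floor_le _).trans ?_
            nlinarith
          exact_mod_cast this
      · exact Eventually.of_forall fun j h => hxV h.1)
  intro ε hε
  obtain ⟨j, hj⟩ := (ht.eventually_lt_const hε).exists
  refine ⟨_, hWS j, ?_⟩
  rwa [← chi_diff (hWV j)]

theorem Xnorm_chi_lt_top {A : Set (Fin n → ℝ)} (hA : MeasurableSet A) (h : volume A < ⊤) :
    Xnorm Q (chi A) < ⊤ := by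
  have := Q.indicator_lt_top A hA h
  unfold Xnorm
  convert this using 2
  funext x
  by_cases hx : x ∈ A <;> simp [hx]

theorem approx_chi (hQ : CompactAC Q) (N : ℕ) (A : Set (Fin n → ℝ)) (hA : MeasurableSet A) :
    Approx Q (chi (A ∩ Metric.ball 0 N)) := by
  have hBm : MeasurableSet (Metric.ball (0 : Fin n → ℝ) (N : ℝ)) := measurableSet_ball
  induction A, hA using MeasurableSpace.induction_on_inter
    (BorelSpace.measurable_eq (α := Fin n → ℝ)) isPiSystem_isOpen with
  | empty =>
    refine approx_chi_open hQ (by simp) N (by simp)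
  | basic U hU =>
    exact approx_chi_open hQ (IsOpen.inter hU Metric.isOpen_ball) N
      (inter_subset_right.trans Metric.ball_subset_closedBall)
  | compl A hA ih =>
    have h1 := approx_chi_open hQ Metric.isOpen_ball N
      (Metric.ball_subset_closedBall (x := (0 : Fin n → ℝ)) (ε := (N : ℝ)))
    have h2 := ih.smul_rat Q (measurable_chi (hA.inter hBm)) (-1) 0
    have h3 := h1.add Q (measurable_chi hBm)
      (by have := measurable_chi (hA.inter hBm); fun_prop) h2
    convert h3 using 1
    funext x
    by_cases hx : x ∈ A <;> by_cases hx' : x ∈ Metric.ball (0 : Fin n → ℝ) (N : ℝ) <;>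
      simp [chi, hx, hx', Set.indicator, -Metric.mem_ball]
  | iUnion A hd hA ih =>
    set B := Metric.ball (0 : Fin n → ℝ) (N : ℝ) with hB
    have hpart : ∀ j : ℕ, Approx Q (chi ((⋃ i ∈ Finset.range j, A i) ∩ B)) := by
      intro j
      induction j with
      | zero =>
        refine approx_chi_open hQ (by simp) N (by simp)
      | succ j ihj =>
        have hm : MeasurableSet (⋃ i ∈ Finset.range j, A i) :=
          Finset.measurableSet_biUnion _ fun i _ => hA i
        have := ihj.add Q (measurable_chi (hm.inter hBm))
          (measurable_chi ((hA j).inter hBm)) (ih j)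
        convert this using 1
        rw [← chi_union]
        · congr 1
          rw [← union_inter_distrib_right]
          congr 1
          rw [Finset.range_add_one, Finset.set_biUnion_insert, union_comm]
        · refine Disjoint.mono inter_subset_left inter_subset_left ?_
          rw [Set.disjoint_iUnion₂_left]
          intro i hi
          exact hd (Finset.mem_range.1 hi).ne
    have hpm : ∀ j : ℕ, MeasurableSet ((⋃ i ∈ Finset.range j, A i) ∩ B) := fun j =>
      (Finset.measurableSet_biUnion _ fun i _ => hA i).inter hBm
    have hUm : MeasurableSet ((⋃ i, A i) ∩ B) := (MeasurableSet.iUnion hA).inter hBm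
    have ht := hQ.tendsto (isCompact_closedBall (0 : Fin n → ℝ) (N : ℝ))
      (fun j => ((⋃ i, A i) ∩ B) \ ((⋃ i ∈ Finset.range j, A i) ∩ B))
      (fun j => hUm.diff (hpm j))
      (fun j => sdiff_subset.trans (inter_subset_right.trans Metric.ball_subset_closedBall)) (by
        refine Eventually.of_forall fun x => ?_
        by_cases hx : x ∈ ⋃ i, A i
        · obtain ⟨i, hi⟩ := mem_iUnion.1 hx
          filter_upwards [eventually_gt_atTop i] with j hj h
          exact h.2 ⟨mem_iUnion₂.2 ⟨i, Finset.mem_range.2 hj, hi⟩, h.1.2⟩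
        · exact Eventually.of_forall fun j h => hx h.1.1)
    refine Approx.of_close Q (measurable_chi hUm) fun ε hε => ?_
    obtain ⟨j, hj⟩ := (ht.eventually_lt_const hε).exists
    refine ⟨_, measurable_chi (hpm j), hpart j, ?_⟩
    rwa [← chi_diff]
    exact inter_subset_inter_left _ (iUnion₂_subset fun i _ => subset_iUnion _ i)

theorem approx_simple (hQ : CompactAC Q) (N : ℕ) (φ : SimpleFunc (Fin n → ℝ) ℂ) :
    Approx Q ((Metric.ball (0 : Fin n → ℝ) (N : ℝ)).indicator φ) := by
  have hBm : MeasurableSet (Metric.ball (0 : Fin n → ℝ) (N : ℝ)) := measurableSet_ball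
  induction φ using SimpleFunc.induction with
  | const c hs =>
    rename_i s
    have hlt : volume (s ∩ Metric.ball (0 : Fin n → ℝ) (N : ℝ)) < ⊤ :=
      lt_of_le_of_lt (measure_mono inter_subset_right) measure_ball_lt_top
    have := (approx_chi hQ N s hs).smul Q (measurable_chi (hs.inter hBm))
      (Xnorm_chi_lt_top (hs.inter hBm) hlt) c
    convert this using 1
    funext x
    by_cases hx : x ∈ s <;> by_cases hx' : x ∈ Metric.ball (0 : Fin n → ℝ) (N : ℝ) <;>
      simp [chi, hx, hx', Set.indicator, -Metric.mem_ball]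
  | add hd h1 h2 =>
    rename_i φ ψ
    have := h1.add Q (φ.measurable.indicator hBm) (ψ.measurable.indicator hBm) h2
    rwa [← Set.indicator_add'] at this

theorem approx_ball (hQ : CompactAC Q) {f : (Fin n → ℝ) → ℂ} (hf : Measurable f)
    (hfAC : HasACNorm Q f) (N : ℕ) :
    Approx Q ((Metric.ball (0 : Fin n → ℝ) (N : ℝ)).indicator f) := by
  have hBm : MeasurableSet (Metric.ball (0 : Fin n → ℝ) (N : ℝ)) := measurableSet_ball
  set B := Metric.ball (0 : Fin n → ℝ) (N : ℝ) with hB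
  let φ := SimpleFunc.approxOn f hf univ 0 (mem_univ _)
  have hφ : ∀ x, Tendsto (fun j => φ j x) atTop (nhds (f x)) := fun x =>
    SimpleFunc.tendsto_approxOn hf (mem_univ _) (by simp)
  have hφle : ∀ x j, ‖φ j x‖ ≤ ‖f x‖ + ‖f x‖ := fun x j =>
    SimpleFunc.norm_approxOn_zero_le hf (mem_univ _) x j
  refine Approx.of_close Q (hf.indicator hBm) fun ε hε => ?_
  obtain ⟨η, hη, H⟩ := exists_split Q ε hε
  have hBlt : Xnorm Q (chi B) < ⊤ := Xnorm_chi_lt_top hBm measure_ball_lt_top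
  obtain ⟨δ, hδ, hδlt⟩ := exists_small_mul_lt _ hBlt η hη
  let F : ℕ → Set (Fin n → ℝ) := fun j => {x | (δ : ℝ) < ‖f x - φ j x‖}
  have hFm : ∀ j, MeasurableSet (F j) := fun j =>
    measurableSet_lt measurable_const (hf.sub (φ j).measurable).norm
  have ht := hfAC.tendsto' Q F hFm (by
    refine Eventually.of_forall fun x => ?_
    have h1 : Tendsto (fun j => ‖f x - φ j x‖) atTop (nhds 0) := by
      simpa using ((tendsto_const_nhds (x := f x)).sub (hφ x)).norm
    filter_upwards [h1.eventually_lt_const (show (0 : ℝ) < δ from hδ)] with j hj h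
    exact lt_asymm hj h)
  have h3pos : 0 < η / (‖(3 : ℂ)‖₊ : ℝ≥0∞) := ENNReal.div_pos hη.ne' ENNReal.coe_ne_top
  obtain ⟨j, hj⟩ := (ht.eventually_lt_const h3pos).exists
  have hj3 := ENNReal.mul_lt_of_lt_div' hj
  rw [← Xnorm_smul Q _ (hf.indicator (hFm j))] at hj3
  have hd : Xnorm Q (fun x => (δ : ℂ) * chi B x) < η := by
    rw [Xnorm_smul Q _ (measurable_chi hBm)]
    simpa using hδlt
  refine ⟨_, (φ j).measurable.indicator hBm, approx_simple hQ N (φ j),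
    lt_of_le_of_lt ?_ (H _ _ hd hj3)⟩
  refine Xnorm_add_le Q ((hf.indicator hBm).sub ((φ j).measurable.indicator hBm))
    (measurable_const.mul (measurable_chi hBm))
    (measurable_const.mul (hf.indicator (hFm j))) fun x => ?_
  by_cases hx : x ∈ B
  · by_cases hxF : x ∈ F j
    · have h1 := norm_sub_le (f x) (φ j x)
      have h2 := hφle x j
      simp only [chi, Pi.sub_apply, Set.indicator_of_mem hx, Set.indicator_of_mem hxF, norm_mul]
      have : (0 : ℝ) ≤ ‖((δ : ℝ) : ℂ)‖ * ‖(1 : ℂ)‖ := by positivity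
      have h3 : ‖(3 : ℂ)‖ = 3 := by simp
      rw [h3]
      linarith
    · have h1 : ‖f x - φ j x‖ ≤ δ := not_lt.1 hxF
      simp only [chi, Pi.sub_apply, Set.indicator_of_mem hx, Set.indicator_of_notMem hxF]
      simpa using h1
  · simp only [Pi.sub_apply, Set.indicator_of_notMem hx, sub_zero, norm_zero]
    positivity

end helpers

/-- Let `X` be a quasi-Banach function space over `(ℝⁿ, λⁿ)` such that `χ_K` has
absolutely continuous quasinorm for every compact `K`. Then every `f ∈ X` with
absolutely continuous quasinorm can be approximated in `‖·‖_X` by functions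
from `𝒮` to within any `ε > 0`. -/
theorem stmt_13 (n : ℕ) (Q : QBFNorm (volume : Measure (Fin n → ℝ)))
    (hK : ∀ K : Set (Fin n → ℝ), IsCompact K →
      HasACNorm Q (K.indicator (fun _ => (1 : ℂ))))
    (f : (Fin n → ℝ) → ℂ) (hf : Measurable f) (hfX : Xnorm Q f < ⊤)
    (hfAC : HasACNorm Q f) :
    ∀ ε : ℝ≥0∞, 0 < ε → ∃ s : (Fin n → ℝ) → ℂ, memS n s ∧ Xnorm Q (f - s) < ε := by
  have hQ : CompactAC Q := hK
  refine Approx.of_close Q hf fun ε hε => ?_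
  have hBm : ∀ N : ℕ, MeasurableSet (Metric.ball (0 : Fin n → ℝ) (N : ℝ)) :=
    fun N => measurableSet_ball
  have ht := hfAC.tendsto' Q (fun N : ℕ => (Metric.ball (0 : Fin n → ℝ) (N : ℝ))ᶜ)
    (fun N => (hBm N).compl) (by
      refine Eventually.of_forall fun x => ?_
      obtain ⟨M, hM⟩ := exists_nat_gt ‖x‖
      filter_upwards [eventually_ge_atTop M] with N hN h
      apply h
      rw [mem_ball_zero_iff]
      exact hM.trans_le (by exact_mod_cast hN))
  obtain ⟨N, hN⟩ := (ht.eventually_lt_const hε).exists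
  refine ⟨_, hf.indicator (hBm N), approx_ball hQ hf hfAC N, ?_⟩
  rwa [← Set.indicator_compl]
end
end

section
/- Let X be a quasi-Banach function space over (ℝⁿ, λⁿ). Then X is separable (i.e. there exists a countable set D ⊆ X such that for every f ∈ X and every ε > 0 there is d ∈ D with ‖f − d‖_X < ε) if and only if X has absolutely continuous quasinorm. -/
open MeasureTheory Filter Set Topology
open scoped ENNReal NNReal

noncomputable section

lemma Xnorm_le_of_norm_le {α : Type*} [MeasurableSpace α] {μ : Measure α} (Q : QBFNorm μ)
    {f g : α → ℂ} (hf : Measurable f) (hg : Measurable g) (h : ∀ x, ‖f x‖ ≤ ‖g x‖) :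
    Xnorm Q f ≤ Xnorm Q g := by
  refine Q.mono _ _ (by fun_prop) (by fun_prop) (Eventually.of_forall fun x => ?_)
  exact_mod_cast h x

lemma Xnorm_sub_le {α : Type*} [MeasurableSpace α] {μ : Measure α} (Q : QBFNorm μ)
    {f g k : α → ℂ} (hf : Measurable f) (hg : Measurable g) (hk : Measurable k) :
    Xnorm Q (f - k) ≤ Q.C * (Xnorm Q (f - g) + Xnorm Q (g - k)) := by
  refine le_trans ?_ (Q.triangle _ _ (by fun_prop) (by fun_prop))
  refine Q.mono _ _ (by fun_prop) (by fun_prop) (Eventually.of_forall fun x => ?_)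
  have : ‖(f - k) x‖₊ ≤ ‖(f - g) x‖₊ + ‖(g - k) x‖₊ := by
    have := nnnorm_add_le ((f - g) x) ((g - k) x)
    simpa using this
  exact_mod_cast this

lemma Xnorm_sub_comm {α : Type*} [MeasurableSpace α] {μ : Measure α} (Q : QBFNorm μ)
    (f g : α → ℂ) : Xnorm Q (f - g) = Xnorm Q (g - f) := by
  unfold Xnorm
  congr 1
  ext x
  simp only [Pi.sub_apply]
  rw [← nnnorm_neg, neg_sub]

lemma Xnorm_dct {α : Type*} [MeasurableSpace α] {μ : Measure α} (Q : QBFNorm μ)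
    {F h : α → ℂ} {g : ℕ → α → ℂ} (hF : Measurable F) (hg : ∀ k, Measurable (g k))
    (hh : Measurable h) (hfin : Xnorm Q h < ⊤) (hac : HasACNorm Q h)
    (hle : ∀ k x, ‖F x - g k x‖ ≤ ‖h x‖)
    (hlim : ∀ᵐ x ∂μ, Tendsto (fun k => g k x) atTop (𝓝 (F x))) :
    Tendsto (fun k => Xnorm Q (F - g k)) atTop (𝓝 0) := by
  rw [ENNReal.tendsto_nhds_zero]
  intro ε hε
  obtain ⟨δ, hδ, hδε⟩ := ENNReal.exists_nnreal_pos_mul_lt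
    (a := Q.C * Xnorm Q h) (b := ε / 2)
    (ENNReal.mul_ne_top ENNReal.coe_ne_top hfin.ne) (ENNReal.half_pos hε.ne').ne'
  let E : ℕ → Set α := fun k => {x | (δ : ℝ) * ‖h x‖ < ‖F x - g k x‖}
  have hE : ∀ k, MeasurableSet (E k) := fun k =>
    measurableSet_lt (by fun_prop) (by have := hg k; fun_prop)
  have hE0 : ∀ᵐ x ∂μ, Tendsto (fun k => (E k).indicator (fun _ => (1 : ℝ)) x) atTop (nhds 0) := by
    filter_upwards [hlim] with x hx
    refine tendsto_const_nhds.congr' ?_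
    have h1 : Tendsto (fun k => ‖F x - g k x‖) atTop (𝓝 0) := by
      simpa using (tendsto_const_nhds.sub hx : Tendsto (fun k => F x - g k x) _ _).norm
    by_cases hx0 : h x = 0
    · refine Eventually.of_forall fun k => ?_
      have := hle k x
      simp only [hx0, norm_zero] at this
      beta_reduce
      rw [indicator_of_notMem]
      simp only [E, mem_ofPred_eq, hx0, norm_zero, mul_zero, not_lt]
      exact this
    · have : 0 < (δ : ℝ) * ‖h x‖ := mul_pos (by exact_mod_cast hδ) (norm_pos_iff.2 hx0)
      filter_upwards [h1.eventually_lt_const this] with k hk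
      rw [indicator_of_notMem]
      simp only [E, mem_ofPred_eq, not_lt]
      exact hk.le
  have h2 := ENNReal.Tendsto.const_mul (a := (Q.C : ℝ≥0∞)) (hac E hE hE0)
    (Or.inr ENNReal.coe_ne_top)
  rw [mul_zero, ENNReal.tendsto_nhds_zero] at h2
  filter_upwards [h2 _ (ENNReal.half_pos hε.ne')] with k hk
  calc Xnorm Q (F - g k) ≤ Q.ρ (fun x => (δ : ℝ≥0∞) * (‖h x‖₊ : ℝ≥0∞)
        + (‖(E k).indicator h x‖₊ : ℝ≥0∞)) := by
        have hgk := hg k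
        have hi := hh.indicator (hE k)
        refine Q.mono _ _ (by fun_prop) (by fun_prop) (Eventually.of_forall fun x => ?_)
        by_cases hx : x ∈ E k
        · rw [indicator_of_mem hx]
          refine le_trans ?_ le_add_self
          exact_mod_cast hle k x
        · refine le_trans ?_ le_self_add
          simp only [E, mem_ofPred_eq, not_lt] at hx
          have : ‖F x - g k x‖₊ ≤ δ * ‖h x‖₊ := by exact_mod_cast hx
          exact_mod_cast this
    _ ≤ Q.C * (δ * Xnorm Q h + Xnorm Q ((E k).indicator h)) := by
        have hi := hh.indicator (hE k)
        refine (Q.triangle _ _ (by fun_prop) (by fun_prop)).trans ?_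
        rw [Q.smul_hom _ _ (by fun_prop)]
        rfl
    _ = δ * (Q.C * Xnorm Q h) + Q.C * Xnorm Q ((E k).indicator h) := by ring
    _ ≤ ε / 2 + ε / 2 := add_le_add hδε.le hk
    _ = ε := ENNReal.add_halves ε

/-- Truncation of a function in value and in support. -/
def truncSet {n : ℕ} (k : ℕ) (d : (Fin n → ℝ) → ℂ) : Set (Fin n → ℝ) :=
  {x | ‖d x‖ ≤ 2 * (k : ℝ) + 1} ∩ Metric.closedBall 0 k

lemma measurableSet_truncSet {n : ℕ} (k : ℕ) {d : (Fin n → ℝ) → ℂ} (hd : Measurable d) :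
    MeasurableSet (truncSet k d) :=
  (measurableSet_le (by fun_prop) (by fun_prop)).inter Metric.isClosed_closedBall.measurableSet

lemma Xnorm_const_indicator {n : ℕ} (Q : QBFNorm (volume : Measure (Fin n → ℝ))) (c : ℝ≥0)
    (k : ℕ) : Xnorm Q ((Metric.closedBall (0 : Fin n → ℝ) k).indicator
      (fun _ => (((c : ℝ≥0) : ℝ) : ℂ))) < ⊤ := by
  have hB : MeasurableSet (Metric.closedBall (0 : Fin n → ℝ) (k : ℝ)) :=
    Metric.isClosed_closedBall.measurableSet
  have h1 := Q.indicator_lt_top _ hB measure_closedBall_lt_top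
  have h2 := Q.smul_hom c _ ((measurable_const (a := (1 : ℝ≥0∞))).indicator hB)
  have h3 : Xnorm Q ((Metric.closedBall (0 : Fin n → ℝ) k).indicator
      (fun _ => (((c : ℝ≥0) : ℝ) : ℂ))) = (c : ℝ≥0∞) *
        Q.ρ ((Metric.closedBall (0 : Fin n → ℝ) (k : ℝ)).indicator fun _ => 1) := by
    rw [← h2]
    unfold Xnorm
    congr 1
    ext x
    by_cases hx : x ∈ Metric.closedBall (0 : Fin n → ℝ) (k : ℝ)
    · simp only [indicator_of_mem hx]
      simp
    · simp only [indicator_of_notMem hx]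
      simp
  rw [h3]
  exact ENNReal.mul_lt_top ENNReal.coe_lt_top h1

lemma separable_of_ac (n : ℕ) (Q : QBFNorm (volume : Measure (Fin n → ℝ)))
    (hac : ∀ f : (Fin n → ℝ) → ℂ, Measurable f → Xnorm Q f < ⊤ → HasACNorm Q f) :
    ∃ D : Set ((Fin n → ℝ) → ℂ), D.Countable ∧
      (∀ d ∈ D, Measurable d ∧ Xnorm Q d < ⊤) ∧
      ∀ f : (Fin n → ℝ) → ℂ, Measurable f → Xnorm Q f < ⊤ →
        ∀ ε : ℝ≥0∞, 0 < ε → ∃ d ∈ D, Xnorm Q (f - d) < ε := by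
  haveI : Fact ((1 : ℝ≥0∞) ≤ 1) := ⟨le_rfl⟩
  haveI : Fact ((1 : ℝ≥0∞) ≠ ⊤) := ⟨ENNReal.one_ne_top⟩
  let L := Lp ℂ 1 (volume : Measure (Fin n → ℝ))
  obtain ⟨S, hSc, hSd⟩ := TopologicalSpace.exists_countable_dense L
  let T : ℕ × L → ((Fin n → ℝ) → ℂ) := fun p => (truncSet p.1 (p.2 : (Fin n → ℝ) → ℂ)).indicator p.2
  have hm : ∀ d : L, Measurable (d : (Fin n → ℝ) → ℂ) := fun d =>
    (Lp.stronglyMeasurable d).measurable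
  have hTm : ∀ p, Measurable (T p) := fun p =>
    (hm p.2).indicator (measurableSet_truncSet _ (hm p.2))
  have hC : ∀ (c : ℝ≥0) (k : ℕ), Measurable ((Metric.closedBall (0 : Fin n → ℝ) k).indicator
      (fun _ => (((c : ℝ≥0) : ℝ) : ℂ))) := fun c k =>
    measurable_const.indicator Metric.isClosed_closedBall.measurableSet
  refine ⟨T '' (univ ×ˢ S), (countable_univ.prod hSc).image _, ?_, ?_⟩
  · rintro _ ⟨⟨k, d⟩, -, rfl⟩
    refine ⟨hTm _, lt_of_le_of_lt (Xnorm_le_of_norm_le Q (hTm _) (hC (2 * k + 1) k) ?_)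
      (Xnorm_const_indicator Q (2 * k + 1) k)⟩
    intro x
    by_cases hx : x ∈ truncSet k (d : (Fin n → ℝ) → ℂ)
    · simp only [T, indicator_of_mem hx, indicator_of_mem hx.2]
      refine hx.1.trans ?_
      rw [Complex.norm_real, Real.norm_of_nonneg (NNReal.coe_nonneg _)]
      push_cast
      rfl
    · simp only [T, indicator_of_notMem hx, norm_zero]
      positivity
  · intro f hf hfin ε hε
    obtain ⟨δ, hδ, hδε⟩ := ENNReal.exists_nnreal_pos_mul_lt
      (a := Q.C * 2) (b := ε)
      (ENNReal.mul_ne_top ENNReal.coe_ne_top (by simp)) hε.ne'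
    have hδ' : (0 : ℝ≥0∞) < δ := by exact_mod_cast hδ
    -- first approximation
    let A : ℕ → Set (Fin n → ℝ) := fun k => {x | ‖f x‖ ≤ k} ∩ Metric.closedBall 0 k
    have hA : ∀ k, MeasurableSet (A k) := fun k =>
      (measurableSet_le (by fun_prop) (by fun_prop)).inter Metric.isClosed_closedBall.measurableSet
    have hfk : ∀ k, Measurable ((A k).indicator f) := fun k => hf.indicator (hA k)
    have h1 : Tendsto (fun k => Xnorm Q (f - (A k).indicator f)) atTop (𝓝 0) := by
      refine Xnorm_dct Q hf hfk hf hfin (hac f hf hfin) ?_ ?_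
      · intro k x
        by_cases hx : x ∈ A k
        · simp [indicator_of_mem hx]
        · simp [indicator_of_notMem hx]
      · refine Eventually.of_forall fun x => tendsto_const_nhds.congr' ?_
        have e1 := (tendsto_natCast_atTop_atTop (R := ℝ)).eventually_ge_atTop ‖f x‖
        have e2 := (tendsto_natCast_atTop_atTop (R := ℝ)).eventually_ge_atTop ‖x‖
        filter_upwards [e1, e2] with k hk1 hk2
        rw [indicator_of_mem]
        exact ⟨hk1, by simpa using hk2⟩
    obtain ⟨k, hk⟩ := (h1.eventually_lt_const hδ').exists
    set F := (A k).indicator f with hFdef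
    have hFn : ∀ x, ‖F x‖ ≤ k := by
      intro x
      by_cases hx : x ∈ A k
      · rw [hFdef, indicator_of_mem hx]; exact hx.1
      · rw [hFdef, indicator_of_notMem hx]; simp
    have hF0 : ∀ x, x ∉ Metric.closedBall (0 : Fin n → ℝ) (k : ℝ) → F x = 0 := by
      intro x hx
      rw [hFdef, indicator_of_notMem]
      exact fun h => hx h.2
    -- membership in L1
    have hFL : MemLp F 1 (volume : Measure (Fin n → ℝ)) := by
      rw [memLp_one_iff_integrable]
      have : IntegrableOn F (Metric.closedBall 0 k) := by
        refine Measure.integrableOn_of_bounded (M := k) measure_closedBall_lt_top.ne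
          (hfk k).aestronglyMeasurable (Eventually.of_forall fun x => hFn x)
      exact this.integrable_of_forall_notMem_eq_zero hF0
    obtain ⟨u, huS, hu⟩ := mem_closure_iff_seq_limit.1 (hSd (hFL.toLp F))
    have hmeas := tendstoInMeasure_of_tendsto_Lp hu
    obtain ⟨ns, -, hns⟩ := hmeas.exists_seq_tendsto_ae
    have hns' : ∀ᵐ x ∂(volume : Measure (Fin n → ℝ)),
        Tendsto (fun i => T (k, u (ns i)) x) atTop (𝓝 (F x)) := by
      filter_upwards [hns, hFL.coeFn_toLp] with x hx hx2
      rw [hx2] at hx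
      by_cases hxb : x ∈ Metric.closedBall (0 : Fin n → ℝ) (k : ℝ)
      · refine hx.congr' ?_
        have : ‖F x‖ < 2 * (k : ℝ) + 1 := by
          have := hFn x
          have : (0 : ℝ) ≤ k := by positivity
          linarith
        filter_upwards [hx.norm.eventually_lt_const this] with i hi
        simp only [T]
        rw [indicator_of_mem]
        exact ⟨hi.le, hxb⟩
      · rw [hF0 x hxb]
        refine tendsto_const_nhds.congr fun i => ?_
        simp only [T]
        rw [indicator_of_notMem]
        exact fun h => hxb h.2
    have h2 := Xnorm_dct Q (hfk k) (fun i => hTm (k, u (ns i))) (hC (3 * k + 1) k)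
      (Xnorm_const_indicator Q (3 * k + 1) k)
      (hac _ (hC (3 * k + 1) k) (Xnorm_const_indicator Q (3 * k + 1) k)) ?_ hns'
    · obtain ⟨i, hi⟩ := (h2.eventually_lt_const hδ').exists
      refine ⟨T (k, u (ns i)), ⟨_, ⟨mem_univ _, huS _⟩, rfl⟩, ?_⟩
      calc Xnorm Q (f - T (k, u (ns i))) ≤ Q.C * (Xnorm Q (f - F) + Xnorm Q (F - T (k, u (ns i)))) :=
            Xnorm_sub_le Q hf (hfk k) (hTm _)
        _ ≤ Q.C * (δ + δ) := by gcongr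
        _ = δ * (Q.C * 2) := by ring
        _ < ε := hδε
    · intro i x
      by_cases hxb : x ∈ Metric.closedBall (0 : Fin n → ℝ) (k : ℝ)
      · rw [indicator_of_mem hxb, Complex.norm_real, Real.norm_of_nonneg (NNReal.coe_nonneg _)]
        have hT : ‖T (k, u (ns i)) x‖ ≤ 2 * (k : ℝ) + 1 := by
          by_cases hx : x ∈ truncSet k (u (ns i) : (Fin n → ℝ) → ℂ)
          · simp only [T, indicator_of_mem hx]; exact hx.1
          · simp only [T, indicator_of_notMem hx, norm_zero]; positivity
        have := norm_sub_le (F x) (T (k, u (ns i)) x)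
        have := hFn x
        push_cast
        linarith
      · have hT : T (k, u (ns i)) x = 0 := by
          simp only [T]
          rw [indicator_of_notMem]
          exact fun h => hxb h.2
        have hF' : (A k).indicator f x = 0 := hF0 x hxb
        rw [hF', hT]
        simp

lemma ac_of_separable {α : Type*} [MeasurableSpace α] {μ : Measure α} (Q : QBFNorm μ)
    (D : Set (α → ℂ)) (hDc : D.Countable) (hDm : ∀ d ∈ D, Measurable d)
    (hD : ∀ f : α → ℂ, Measurable f → Xnorm Q f < ⊤ →
        ∀ ε : ℝ≥0∞, 0 < ε → ∃ d ∈ D, Xnorm Q (f - d) < ε)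
    (f : α → ℂ) (hf : Measurable f) (hfin : Xnorm Q f < ⊤) : HasACNorm Q f := by
  intro E hE hE0
  by_contra hcon
  rw [ENNReal.tendsto_nhds_zero] at hcon
  push Not at hcon
  obtain ⟨ε, hε, hfreq⟩ := hcon
  let F : ℕ → Set α := fun k => ⋃ j ≥ k, E j
  have hF : ∀ k, MeasurableSet (F k) := fun k =>
    MeasurableSet.iUnion fun j => MeasurableSet.iUnion fun _ => hE j
  have hFanti : Antitone F := fun a b hab =>
    biUnion_subset_biUnion_left fun j (hj : b ≤ j) => le_trans hab hj
  have hFε : ∀ k, ε < Xnorm Q ((F k).indicator f) := by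
    intro k
    obtain ⟨j, hj, hj2⟩ := (frequently_atTop.1 hfreq) k
    refine hj2.trans_le (Xnorm_le_of_norm_le Q (hf.indicator (hE j)) (hf.indicator (hF k)) ?_)
    intro x
    exact norm_indicator_le_of_subset (subset_biUnion_of_mem (u := E) (show j ∈ {j | j ≥ k} from hj)) f x
  have hnull : ∀ᵐ x ∂μ, ∃ m, x ∉ F m := by
    filter_upwards [hE0] with x hx
    obtain ⟨m, hm⟩ := eventually_atTop.1 (hx.eventually_lt_const (zero_lt_one))
    refine ⟨m, fun hxm => ?_⟩
    simp only [F, mem_iUnion] at hxm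
    obtain ⟨j, hj, hxj⟩ := hxm
    have := hm j hj
    rw [indicator_of_mem hxj] at this
    exact lt_irrefl _ this
  have hstep : ∀ k, ∃ m, ε < Xnorm Q ((F k \ F m).indicator f) := by
    intro k
    have hmd : ∀ m, Measurable ((F k \ F m).indicator f) := fun m =>
      hf.indicator ((hF k).diff (hF m))
    have h1 := Q.fatou (fun m x => (‖(F k \ F m).indicator f x‖₊ : ℝ≥0∞))
      (fun m => by have := hmd m; fun_prop) (Eventually.of_forall fun x a b hab => by
        have := norm_indicator_le_of_subset (sdiff_subset_sdiff_right (s := F k) (hFanti hab)) f x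
        beta_reduce
        exact_mod_cast this)
    have h2 : Xnorm Q ((F k).indicator f) =
        ⨆ m, Xnorm Q ((F k \ F m).indicator f) := by
      refine Eq.trans ?_ h1
      refine Q.congr_ae _ _ ?_ ?_ ?_
      · have := hf.indicator (hF k); fun_prop
      · exact Measurable.iSup fun m => by have := hmd m; fun_prop
      · filter_upwards [hnull] with x hx
        obtain ⟨m, hm⟩ := hx
        refine le_antisymm (le_iSup_of_le m ?_) (iSup_le fun i => ?_)
        · have : (F k \ F m).indicator f x = (F k).indicator f x := by
            by_cases hx : x ∈ F k
            · rw [indicator_of_mem hx, indicator_of_mem (show x ∈ F k \ F m from ⟨hx, hm⟩)]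
            · rw [indicator_of_notMem hx, indicator_of_notMem (fun h => hx h.1)]
          rw [this]
        · have := norm_indicator_le_of_subset (diff_subset : F k \ F i ⊆ F k) f x
          exact_mod_cast this
    have h3 := hFε k
    rw [h2] at h3
    exact lt_iSup_iff.1 h3
  choose g hg using hstep
  have hgk : ∀ k, k ≤ g k := by
    intro k
    by_contra hlt
    have : F k \ F (g k) = ∅ := diff_eq_empty.2 (hFanti (not_le.1 hlt).le)
    have h0 := hg k
    rw [this] at h0
    have : Xnorm Q ((∅ : Set α).indicator f) = 0 := by
      unfold Xnorm
      rw [Q.eq_zero_iff _ (by simp)]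
      simp
      rfl
    rw [this] at h0
    exact not_lt_bot h0
  let m : ℕ → ℕ := fun i => g^[i] 0
  have hms : ∀ i, m (i + 1) = g (m i) := fun i => Function.iterate_succ_apply' g i 0
  have hmm : Monotone m := monotone_nat_of_le_succ fun i => by rw [hms]; exact hgk _
  let G : ℕ → Set α := fun i => F (m i) \ F (m (i + 1))
  have hGε : ∀ i, ε < Xnorm Q ((G i).indicator f) := fun i => by
    simp only [G, hms]; exact hg _
  have hGm : ∀ i, MeasurableSet (G i) := fun i => (hF _).diff (hF _)
  have hGd : ∀ i j x, x ∈ G i → x ∈ G j → i = j := by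
    intro i j x hi hj
    by_contra hne
    rcases lt_or_gt_of_ne hne with h | h
    · exact hi.2 (hFanti (hmm (Nat.succ_le_of_lt h)) hj.1)
    · exact hj.2 (hFanti (hmm (Nat.succ_le_of_lt h)) hi.1)
  let U : Set ℕ → Set α := fun S => ⋃ i ∈ S, G i
  have hU : ∀ S, MeasurableSet (U S) := fun S =>
    MeasurableSet.iUnion fun j => MeasurableSet.iUnion fun _ => hGm j
  let φ : Set ℕ → α → ℂ := fun S => (U S).indicator f
  have hφm : ∀ S, Measurable (φ S) := fun S => hf.indicator (hU S)
  have hφfin : ∀ S, Xnorm Q (φ S) < ⊤ := fun S =>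
    (Xnorm_le_of_norm_le Q (hφm S) hf fun x => norm_indicator_le_norm_self f x).trans_lt hfin
  have hsep : ∀ S S' : Set ℕ, ∀ i, i ∈ S → i ∉ S' → ε < Xnorm Q (φ S - φ S') := by
    intro S S' i hi hi'
    refine (hGε i).trans_le (Xnorm_le_of_norm_le Q (hf.indicator (hGm i))
      ((hφm S).sub (hφm S')) fun x => ?_)
    by_cases hx : x ∈ G i
    · have h1 : x ∈ U S := mem_biUnion hi hx
      have h2 : x ∉ U S' := by
        intro h
        simp only [U, mem_iUnion] at h
        obtain ⟨j, hj, hxj⟩ := h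
        exact hi' (hGd i j x hx hxj ▸ hj)
      simp [φ, indicator_of_mem hx, indicator_of_mem h1, indicator_of_notMem h2]
    · rw [indicator_of_notMem hx]; simp
  obtain ⟨δ, hδ, hδε⟩ := ENNReal.exists_nnreal_pos_mul_lt
    (a := Q.C * 2) (b := ε)
    (ENNReal.mul_ne_top ENNReal.coe_ne_top (by simp)) hε.ne'
  have hδ' : (0 : ℝ≥0∞) < δ := by exact_mod_cast hδ
  choose d hdD hd using fun S => hD (φ S) (hφm S) (hφfin S) δ hδ'
  have hclose : ∀ S S', d S = d S' → Xnorm Q (φ S - φ S') < ε := by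
    intro S S' h
    calc Xnorm Q (φ S - φ S') ≤ Q.C * (Xnorm Q (φ S - d S) + Xnorm Q (d S - φ S')) :=
          Xnorm_sub_le Q (hφm S) (hDm _ (hdD S)) (hφm S')
      _ ≤ Q.C * (δ + δ) := by
          gcongr
          · exact (hd S).le
          · rw [h, Xnorm_sub_comm]; exact (hd S').le
      _ = δ * (Q.C * 2) := by ring
      _ < ε := hδε
  have hinj : Function.Injective d := by
    intro S S' h
    ext i
    constructor
    · intro hi
      by_contra hi'
      exact lt_asymm (hsep S S' i hi hi') (hclose S S' h)
    · intro hi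
      by_contra hi'
      exact lt_asymm (hsep S' S i hi hi') (hclose S' S h.symm)
  have hct : Countable (Set ℕ) := by
    haveI := hDc.to_subtype
    exact Function.Injective.countable (f := fun S => (⟨d S, hdD S⟩ : D))
      fun S S' h => hinj (Subtype.ext_iff.1 h)
  obtain ⟨e, he⟩ := hct.exists_injective_nat'
  exact Function.cantor_injective e he

/-- A quasi-Banach function space `X` over `(ℝⁿ, λⁿ)` is separable (there is a
countable set `D ⊆ X` such that every `f ∈ X` is within `ε` of some `d ∈ D`, for
every `ε > 0`) if and only if `X` has absolutely continuous quasinorm. -/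
theorem stmt_14 (n : ℕ) (Q : QBFNorm (volume : Measure (Fin n → ℝ))) :
    (∃ D : Set ((Fin n → ℝ) → ℂ), D.Countable ∧
      (∀ d ∈ D, Measurable d ∧ Xnorm Q d < ⊤) ∧
      ∀ f : (Fin n → ℝ) → ℂ, Measurable f → Xnorm Q f < ⊤ →
        ∀ ε : ℝ≥0∞, 0 < ε → ∃ d ∈ D, Xnorm Q (f - d) < ε)
    ↔
    (∀ f : (Fin n → ℝ) → ℂ, Measurable f → Xnorm Q f < ⊤ → HasACNorm Q f) := by
  constructor
  · rintro ⟨D, hDc, hDm, hD⟩ f hf hfin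
    exact ac_of_separable Q D hDc (fun d hd => (hDm d hd).1) hD f hf hfin
  · exact separable_of_ac n Q
end
end

section
/- Let X be a rearrangement-invariant quasi-Banach function space over (ℝⁿ, λⁿ). Let s = sup{ a ∈ (0,∞) : D_a is not bounded on X } (with sup ∅ = 0). Then s is equal to either zero or one. -/
open MeasureTheory Filter Set Topology
open scoped ENNReal NNReal

noncomputable section

/-- The non-increasing rearrangement of `f ∈ M⁺`:
`f*(t) = inf {s : μ {x | s < f x} ≤ t}`. -/
def rearr {α : Type*} [MeasurableSpace α] (μ : Measure α) (f : α → ℝ≥0∞) (t : ℝ) : ℝ≥0∞ :=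
  sInf {s : ℝ≥0∞ | μ {x | s < f x} ≤ ENNReal.ofReal t}

/-- The non-increasing rearrangement `f*` of a complex-valued function `f`. -/
def decRearr {α : Type*} [MeasurableSpace α] (μ : Measure α) (f : α → ℂ) (t : ℝ) : ℝ≥0∞ :=
  rearr μ (fun x => (‖f x‖₊ : ℝ≥0∞)) t

/-- The quasi-Banach function space induced by `Q` over `(ℝⁿ, λⁿ)` is
rearrangement invariant: `‖f‖_X = ‖g‖_X` whenever `f* = g*`. -/
def RearrInv (n : ℕ) (Q : QBFNorm (volume : Measure (Fin n → ℝ))) : Prop :=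
  ∀ f g : (Fin n → ℝ) → ℂ, Measurable f → Measurable g →
    (∀ t : ℝ, decRearr volume f t = decRearr volume g t) → Xnorm Q f = Xnorm Q g

/-- The dilation operator `D_a f x = f (a • x)` is bounded on `X`. -/
def DilBounded (n : ℕ) (Q : QBFNorm (volume : Measure (Fin n → ℝ))) (a : ℝ) : Prop :=
  ∃ K : ℝ≥0∞, K < ⊤ ∧ ∀ f : (Fin n → ℝ) → ℂ, Measurable f → Xnorm Q f < ⊤ →
    Xnorm Q (fun x => f (a • x)) ≤ K * Xnorm Q f

lemma exists_sub_vol (n : ℕ) (hn : n ≠ 0) (A : Set (Fin n → ℝ)) (hA : MeasurableSet A)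
    (c : ℝ≥0∞) (hc : c < volume A) (hfin : volume A ≠ ⊤) :
    ∃ S ⊆ A, MeasurableSet S ∧ volume S = c := by
  have : Nonempty (Fin n) := ⟨⟨0, Nat.pos_of_ne_zero hn⟩⟩
  let F : ℝ → ℝ≥0∞ := fun r => ∫⁻ x in A, (Metric.closedBall (0 : Fin n → ℝ) r).indicator 1 x
  have hF : ∀ r, F r = volume (A ∩ Metric.closedBall (0 : Fin n → ℝ) r) := by
    intro r
    simp only [F]
    rw [lintegral_indicator_one Metric.isClosed_closedBall.measurableSet,
      Measure.restrict_apply Metric.isClosed_closedBall.measurableSet, inter_comm]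
  have hcont : Continuous F := by
    rw [continuous_iff_continuousAt]
    intro r
    refine tendsto_lintegral_filter_of_dominated_convergence (fun _ => 1) ?_ ?_ ?_ ?_
    · exact Eventually.of_forall fun s =>
        measurable_one.indicator Metric.isClosed_closedBall.measurableSet
    · refine Eventually.of_forall fun s => Eventually.of_forall fun x => ?_
      exact indicator_le_self' (fun _ _ => zero_le) x
    · simpa using hfin
    · have h0 : ∀ᵐ x ∂(volume.restrict A), x ∉ Metric.sphere (0 : Fin n → ℝ) r := by
        refine ae_restrict_of_ae ?_
        exact measure_eq_zero_iff_ae_notMem.1 (Measure.addHaar_sphere volume 0 r)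
      filter_upwards [h0] with x hx
      have hx' : ‖x‖ ≠ r := by simpa using hx
      rcases lt_or_gt_of_ne hx' with h | h
      · refine tendsto_nhds_of_eventually_eq ?_
        filter_upwards [lt_mem_nhds h] with s hs
        rw [indicator_of_mem, indicator_of_mem] <;> simp [h.le, le_of_lt hs]
      · refine tendsto_nhds_of_eventually_eq ?_
        filter_upwards [gt_mem_nhds h] with s hs
        rw [indicator_of_notMem, indicator_of_notMem] <;> simp [h, hs]
  have hlim : Tendsto (fun k : ℕ => F k) atTop (𝓝 (volume A)) := by
    have h1 : A = ⋃ k : ℕ, A ∩ Metric.closedBall (0 : Fin n → ℝ) k := by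
      rw [← inter_iUnion, Metric.iUnion_closedBall_nat, inter_univ]
    simp only [hF]
    conv => rhs; rw [h1]
    apply tendsto_measure_iUnion_atTop
    intro i j hij
    exact inter_subset_inter_right _ (Metric.closedBall_subset_closedBall (by exact_mod_cast hij))
  obtain ⟨k, hk⟩ := (hlim.eventually (lt_mem_nhds hc)).exists
  have h0 : F (-1) ≤ c := by
    rw [hF, Metric.closedBall_eq_empty.2 (by norm_num)]; simp
  obtain ⟨r, hr⟩ := mem_range_of_exists_le_of_exists_ge hcont ⟨_, h0⟩ ⟨_, hk.le⟩
  exact ⟨_, inter_subset_left, hA.inter Metric.isClosed_closedBall.measurableSet,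
    by rw [← hF, hr]⟩

lemma exists_sub_theta (n : ℕ) (θ : ℝ≥0∞) (h0 : θ ≠ 0) (h1 : θ ≤ 1) (hn : n = 0 → θ = 1)
    (A : Set (Fin n → ℝ)) (hA : MeasurableSet A) :
    ∃ S ⊆ A, MeasurableSet S ∧ volume S = θ * volume A := by
  by_cases hfin : volume A = ⊤
  · exact ⟨A, le_rfl, hA, by rw [hfin, ENNReal.mul_top h0]⟩
  have hle : θ * volume A ≤ volume A := by
    simpa using mul_le_mul_left h1 (volume A)
  rcases hle.eq_or_lt with h | h
  · exact ⟨A, le_rfl, hA, h.symm⟩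
  · refine exists_sub_vol n ?_ A hA _ h hfin
    intro h'
    rw [hn h', one_mul] at h
    exact lt_irrefl _ h

lemma exists_mix (n : ℕ) (θ : ℝ≥0∞) (h0 : θ ≠ 0) (h1 : θ ≤ 1) (hn : n = 0 → θ = 1)
    (g : SimpleFunc (Fin n → ℝ) ℝ≥0∞) :
    ∃ S, MeasurableSet S ∧ ∀ T : Set ℝ≥0∞, volume (S ∩ g ⁻¹' T) = θ * volume (g ⁻¹' T) := by
  choose S hS hSm hSv using fun c : ℝ≥0∞ =>
    exists_sub_theta n θ h0 h1 hn (g ⁻¹' {c}) (g.measurableSet_fiber c)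
  refine ⟨⋃ c ∈ g.range, S c, g.range.measurableSet_biUnion fun c _ => hSm c, fun T => ?_⟩
  classical
  have e1 : (⋃ c ∈ g.range, S c) ∩ g ⁻¹' T = ⋃ c ∈ g.range.filter (· ∈ T), S c := by
    ext x
    simp only [mem_inter_iff, mem_iUnion, mem_preimage, Finset.mem_filter, exists_prop]
    constructor
    · rintro ⟨⟨c, hc, hx⟩, hT⟩
      have : g x = c := hS c hx
      exact ⟨c, ⟨hc, this ▸ hT⟩, hx⟩
    · rintro ⟨c, ⟨hc, hT⟩, hx⟩
      have : g x = c := hS c hx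
      exact ⟨⟨c, hc, hx⟩, this ▸ hT⟩
  have e2 : g ⁻¹' T = ⋃ c ∈ g.range.filter (· ∈ T), g ⁻¹' {c} := by
    ext x
    simp
  have hd : Pairwise (Function.onFun Disjoint fun c : ℝ≥0∞ => g ⁻¹' {c}) := by
    intro c d hcd
    exact Disjoint.preimage _ (by simpa using hcd)
  rw [e1]
  conv => rhs; rw [e2]
  rw [measure_biUnion_finset (fun c _ d _ hcd => (hd hcd).mono (hS c) (hS d)) fun c _ => hSm c,
    measure_biUnion_finset (fun c _ d _ hcd => hd hcd) fun c _ => g.measurableSet_fiber c,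
    Finset.mul_sum]
  exact Finset.sum_congr rfl fun c _ => hSv c

lemma rho_eq_of_distr (n : ℕ) (Q : QBFNorm (volume : Measure (Fin n → ℝ)))
    (hri : RearrInv n Q) (f g : (Fin n → ℝ) → ℝ≥0∞) (hf : Measurable f) (hg : Measurable g)
    (hf' : ∀ x, f x ≠ ⊤) (hg' : ∀ x, g x ≠ ⊤)
    (h : ∀ s, volume {x | s < f x} = volume {x | s < g x}) : Q.ρ f = Q.ρ g := by
  have key : ∀ u : (Fin n → ℝ) → ℝ≥0∞, (∀ x, u x ≠ ⊤) →
      (fun x => ((‖(((u x).toReal : ℝ) : ℂ)‖₊ : ℝ≥0) : ℝ≥0∞)) = u := by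
    intro u hu
    ext1 x
    have : ‖(((u x).toReal : ℝ) : ℂ)‖₊ = (u x).toNNReal := by
      ext
      simp
      rfl
    rw [this, ENNReal.coe_toNNReal (hu x)]
  have := hri (fun x => (((f x).toReal : ℝ) : ℂ)) (fun x => (((g x).toReal : ℝ) : ℂ))
    (Complex.measurable_ofReal.comp hf.ennreal_toReal)
    (Complex.measurable_ofReal.comp hg.ennreal_toReal) (by
      intro t
      unfold decRearr
      rw [key f hf', key g hg']
      unfold rearr
      simp only [h])
  unfold Xnorm at this
  rwa [key f hf', key g hg'] at this

lemma rho_dil_simple (n : ℕ) (Q : QBFNorm (volume : Measure (Fin n → ℝ)))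
    (hri : RearrInv n Q) (a : ℝ) (ha : 1 ≤ a) (g : SimpleFunc (Fin n → ℝ) ℝ≥0∞)
    (hg : ∀ x, g x ≠ ⊤) : Q.ρ (fun x => g (a • x)) ≤ Q.ρ g := by
  have ha0 : 0 < a := by linarith
  obtain ⟨S, hS, hST⟩ := exists_mix n
    (ENNReal.ofReal |(a ^ Module.finrank ℝ (Fin n → ℝ))⁻¹|)
    (by simp; positivity)
    (by
      rw [abs_of_nonneg (by positivity)]
      exact ENNReal.ofReal_le_one.2 (inv_le_one_of_one_le₀ (one_le_pow₀ ha)))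
    (by rintro rfl; simp) g
  have hm : Measurable (S.indicator g) := g.measurable.indicator hS
  have hmd : Measurable fun x => g (a • x) := g.measurable.comp (measurable_const_smul a)
  have e : Q.ρ (fun x => g (a • x)) = Q.ρ (S.indicator g) := by
    refine rho_eq_of_distr n Q hri _ _ hmd hm
      (fun x => hg _) ?_ ?_
    · intro x
      by_cases hx : x ∈ S <;> simp [hx, hg]
    · intro s
      have h1 := Measure.addHaar_preimage_smul (volume : Measure (Fin n → ℝ)) ha0.ne'
        (g ⁻¹' Ioi s)
      rw [← hST] at h1
      have h2 : {x | s < S.indicator g x} = S ∩ g ⁻¹' Ioi s := by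
        ext x
        by_cases hx : x ∈ S <;> simp [hx]
      rw [h2, ← h1]
      rfl
  rw [e]
  exact Q.mono _ _ hm g.measurable (Eventually.of_forall fun x => indicator_le_self' (fun _ _ => zero_le) x)

lemma dil_bounded_ge_one (n : ℕ) (Q : QBFNorm (volume : Measure (Fin n → ℝ)))
    (hri : RearrInv n Q) (a : ℝ) (ha : 1 ≤ a) : DilBounded n Q a := by
  refine ⟨1, by simp, fun f hf _ => ?_⟩
  rw [one_mul]
  unfold Xnorm
  set u : (Fin n → ℝ) → ℝ≥0∞ := fun x => (‖f x‖₊ : ℝ≥0∞) with hu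
  have hum : Measurable u := hf.nnnorm.coe_nnreal_ennreal
  change Q.ρ (fun x => u (a • x)) ≤ Q.ρ u
  have e1 : u = fun x => ⨆ k, SimpleFunc.eapprox u k x := by
    ext1 x
    rw [SimpleFunc.iSup_eapprox_apply hum]
  have e2 : (fun x => u (a • x)) = fun x => ⨆ k, SimpleFunc.eapprox u k (a • x) := by
    ext1 x
    rw [SimpleFunc.iSup_eapprox_apply hum]
  have f1 := Q.fatou (fun k => SimpleFunc.eapprox u k) (fun k => SimpleFunc.measurable _)
    (Eventually.of_forall fun x i j hij => SimpleFunc.monotone_eapprox u hij x)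
  have f2 := Q.fatou (fun k x => SimpleFunc.eapprox u k (a • x))
    (fun k => (SimpleFunc.measurable _).comp (measurable_const_smul a))
    (Eventually.of_forall fun x i j hij => SimpleFunc.monotone_eapprox u hij (a • x))
  rw [e2, f2]
  conv => rhs; rw [e1]
  rw [f1]
  exact iSup_mono fun k => rho_dil_simple n Q hri a ha _
    fun x => (SimpleFunc.eapprox_lt_top u k x).ne

lemma dil_bounded_pow (n : ℕ) (Q : QBFNorm (volume : Measure (Fin n → ℝ)))
    (a : ℝ) (h : DilBounded n Q a) (k : ℕ) : DilBounded n Q (a ^ k) := by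
  induction k with
  | zero => exact ⟨1, by simp, fun f _ _ => by simp⟩
  | succ k ih =>
    obtain ⟨K, hK, h⟩ := h
    obtain ⟨L, hL, ih⟩ := ih
    refine ⟨K * L, ENNReal.mul_lt_top hK hL, fun f hf hfin => ?_⟩
    have h1 := ih f hf hfin
    have h2 := h (fun x => f (a ^ k • x)) (hf.comp (measurable_const_smul _))
      (h1.trans_lt (ENNReal.mul_lt_top hL hfin))
    have e : (fun x : Fin n → ℝ => f (a ^ (k + 1) • x)) = fun x => f (a ^ k • a • x) := by
      ext1 x
      rw [smul_smul, pow_succ]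
    rw [e, mul_assoc]
    exact h2.trans (by gcongr)

/-- Let `X` be a rearrangement-invariant quasi-Banach function space over
`(ℝⁿ, λⁿ)` and `s = sup {a ∈ (0,∞) : D_a is not bounded on X}` (with `sup ∅ = 0`).
Then `s` equals zero or one. -/
theorem stmt_16 (n : ℕ) (Q : QBFNorm (volume : Measure (Fin n → ℝ)))
    (hri : RearrInv n Q) :
    sSup {a : ℝ | 0 < a ∧ ¬ DilBounded n Q a} = 0 ∨
    sSup {a : ℝ | 0 < a ∧ ¬ DilBounded n Q a} = 1 := by
  rcases Set.eq_empty_or_nonempty {a : ℝ | 0 < a ∧ ¬ DilBounded n Q a} with h | ⟨a, ha, hab⟩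
  · left
    rw [h, Real.sSup_empty]
  · right
    have hlt : ∀ b ∈ {a : ℝ | 0 < a ∧ ¬ DilBounded n Q a}, b ≤ 1 := by
      rintro b ⟨_, hb⟩
      by_contra hb1
      exact hb (dil_bounded_ge_one n Q hri b (le_of_not_ge hb1))
    have hroot : ∀ k : ℕ, a ^ ((1 : ℝ) / ((k : ℝ) + 1)) ∈
        {a : ℝ | 0 < a ∧ ¬ DilBounded n Q a} := by
      intro k
      refine ⟨Real.rpow_pos_of_pos ha _, fun hb => hab ?_⟩
      have := dil_bounded_pow n Q _ hb (k + 1)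
      rw [← Real.rpow_natCast, ← Real.rpow_mul ha.le] at this
      have e : (1 : ℝ) / ((k : ℝ) + 1) * ((k + 1 : ℕ) : ℝ) = 1 := by
        push_cast
        field_simp
      rwa [e, Real.rpow_one] at this
    have hlim : Tendsto (fun k : ℕ => a ^ ((1 : ℝ) / ((k : ℝ) + 1))) atTop (𝓝 1) := by
      have := (Real.continuous_const_rpow ha.ne').tendsto 0 |>.comp
        (tendsto_one_div_add_atTop_nhds_zero_nat (𝕜 := ℝ))
      simpa [Function.comp_def] using this
    refine le_antisymm (csSup_le ⟨_, hroot 0⟩ hlt) ?_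
    exact le_of_tendsto hlim (Eventually.of_forall fun k => le_csSup ⟨1, hlt⟩ (hroot k))
end
end

section
/- Let g be a Lebesgue-measurable function on (0,∞), let g* denote its non-increasing rearrangement, and set G₁ = ⋃_{k∈ℤ} (2^{-(2k+2)}, 2^{-(2k+1)}) and G₂ = ⋃_{k∈ℤ} (2^{-(2k+1)}, 2^{-2k}). Then for i = 1, 2 and almost every t ∈ (0,∞), (g*·χ_{G_i})*(t) ≤ g*((3/2)·t). -/
open MeasureTheory Filter Set
open scoped ENNReal

noncomputable section

/-- Lebesgue measure on `(0, ∞)`. -/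
def nuPos : Measure ℝ := volume.restrict (Set.Ioi (0 : ℝ))

/-- `G₁ = ⋃_{k ∈ ℤ} (2^{-(2k+2)}, 2^{-(2k+1)})`. -/
def G1 : Set ℝ := ⋃ k : ℤ, Set.Ioo ((2 : ℝ) ^ (-(2 * k + 2))) ((2 : ℝ) ^ (-(2 * k + 1)))

/-- `G₂ = ⋃_{k ∈ ℤ} (2^{-(2k+1)}, 2^{-2k})`. -/
def G2 : Set ℝ := ⋃ k : ℤ, Set.Ioo ((2 : ℝ) ^ (-(2 * k + 1))) ((2 : ℝ) ^ (-(2 * k)))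

lemma vol_half_bound (G : Set ℝ) (hG : MeasurableSet G) (hd : ∀ x ∈ G, 2 * x ∉ G) (t : ℝ)
    (ht : 0 < t) : volume (G ∩ Set.Ioo 0 (3 / 2 * t)) ≤ ENNReal.ofReal t := by
  set A := G ∩ Set.Ioo 0 (3 / 2 * t) with hA
  have hAm : MeasurableSet A := hG.inter measurableSet_Ioo
  have hP : volume ((fun x : ℝ => 2 * x) ⁻¹' A) = ENNReal.ofReal (1 / 2) * volume A := by
    rw [Real.volume_preimage_mul_left (by norm_num)]
    congr 2
    rw [abs_of_pos (by norm_num)]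
    norm_num
  have hdis : Disjoint A ((fun x : ℝ => 2 * x) ⁻¹' A) := by
    rw [Set.disjoint_left]
    intro x hx hx2
    exact hd x hx.1 hx2.1
  have hsub : A ∪ ((fun x : ℝ => 2 * x) ⁻¹' A) ⊆ Set.Ioo 0 (3 / 2 * t) := by
    rintro x (hx | hx)
    · exact hx.2
    · have h1 := hx.2.1
      have h2 := hx.2.2
      simp only at h1 h2
      constructor <;> linarith
  have hle := measure_mono (μ := volume) hsub
  rw [measure_union hdis (hAm.preimage (by fun_prop)), hP, Real.volume_Ioo] at hle
  have hfin : volume A ≠ ⊤ := by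
    refine ne_top_of_le_ne_top ?_ (measure_mono (μ := volume) (Set.inter_subset_right))
    rw [Real.volume_Ioo]
    exact ENNReal.ofReal_ne_top
  rw [← ENNReal.ofReal_toReal hfin] at hle ⊢
  have hn : 0 ≤ (volume A).toReal := ENNReal.toReal_nonneg
  rw [← ENNReal.ofReal_mul (by norm_num), ← ENNReal.ofReal_add hn (by positivity),
    ENNReal.ofReal_le_ofReal_iff (by linarith)] at hle
  apply ENNReal.ofReal_le_ofReal
  linarith

lemma dyadic_no_double (m n : ℤ) (x : ℝ) (h1 : (2 : ℝ) ^ m < x) (h2 : x < (2 : ℝ) ^ (m + 1))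
    (h3 : (2 : ℝ) ^ n < 2 * x) (h4 : 2 * x < (2 : ℝ) ^ (n + 1)) : n = m + 1 := by
  have e1 : (2 : ℝ) ^ (m + 1) = 2 ^ m * 2 := zpow_add_one₀ (by norm_num) m
  have e2 : (2 : ℝ) ^ (m + 1 + 1) = 2 ^ (m + 1) * 2 := zpow_add_one₀ (by norm_num) (m + 1)
  have a1 : (2 : ℝ) ^ (m + 1) < 2 ^ (n + 1) := by linarith
  have a2 : (2 : ℝ) ^ n < 2 ^ (m + 1 + 1) := by linarith
  rw [zpow_lt_zpow_iff_right₀ (by norm_num)] at a1 a2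
  omega

lemma G1_no_double : ∀ x ∈ G1, 2 * x ∉ G1 := by
  intro x hx hx2
  simp only [G1, Set.mem_iUnion, Set.mem_Ioo] at hx hx2
  obtain ⟨k, h1, h2⟩ := hx
  obtain ⟨l, h3, h4⟩ := hx2
  have := dyadic_no_double (-(2 * k + 2)) (-(2 * l + 2)) x h1
    (lt_of_lt_of_eq h2 (congrArg _ (by ring))) h3 (lt_of_lt_of_eq h4 (congrArg _ (by ring)))
  omega

lemma G2_no_double : ∀ x ∈ G2, 2 * x ∉ G2 := by
  intro x hx hx2
  simp only [G2, Set.mem_iUnion, Set.mem_Ioo] at hx hx2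
  obtain ⟨k, h1, h2⟩ := hx
  obtain ⟨l, h3, h4⟩ := hx2
  have := dyadic_no_double (-(2 * k + 1)) (-(2 * l + 1)) x h1
    (lt_of_lt_of_eq h2 (congrArg _ (by ring))) h3 (lt_of_lt_of_eq h4 (congrArg _ (by ring)))
  omega

lemma rearr_indicator_le (f : ℝ → ℝ≥0∞) (G : Set ℝ) (hG : MeasurableSet G)
    (hd : ∀ x ∈ G, 2 * x ∉ G) (t : ℝ) (ht : 0 < t) :
    rearr nuPos (G.indicator (rearr nuPos f)) t ≤ rearr nuPos f (3 / 2 * t) := by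
  apply sInf_le_sInf
  intro s hs
  simp only [Set.mem_setOf_eq] at hs ⊢
  refine le_trans ?_ (vol_half_bound G hG hd t ht)
  have : nuPos {x | s < G.indicator (rearr nuPos f) x} ≤ nuPos (G ∩ Set.Iio (3 / 2 * t)) := by
    apply measure_mono
    intro x hx
    simp only [Set.mem_setOf_eq] at hx
    have hxG : x ∈ G := by
      by_contra h
      rw [Set.indicator_of_notMem h] at hx
      exact not_lt_bot hx
    rw [Set.indicator_of_mem hxG] at hx
    refine ⟨hxG, ?_⟩
    by_contra h
    rw [Set.mem_Iio, not_lt] at h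
    refine absurd hx (not_lt.mpr (sInf_le ?_))
    exact hs.trans (ENNReal.ofReal_le_ofReal h)
  refine this.trans ?_
  rw [nuPos, Measure.restrict_apply (hG.inter measurableSet_Iio)]
  apply measure_mono
  rintro x ⟨⟨h1, h2⟩, h3⟩
  exact ⟨h1, h3, h2⟩

/-- For a Lebesgue-measurable function `g` on `(0,∞)` with non-increasing
rearrangement `g*`, for `i = 1, 2` and a.e. `t ∈ (0,∞)`,
`(g*·χ_{G_i})*(t) ≤ g*((3/2)·t)`. -/
theorem stmt_17 (g : ℝ → ℂ) (hg : Measurable g) :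
    (∀ᵐ t ∂nuPos,
      rearr nuPos (G1.indicator (rearr nuPos (fun x => (‖g x‖₊ : ℝ≥0∞)))) t ≤
        rearr nuPos (fun x => (‖g x‖₊ : ℝ≥0∞)) (3 / 2 * t)) ∧
    (∀ᵐ t ∂nuPos,
      rearr nuPos (G2.indicator (rearr nuPos (fun x => (‖g x‖₊ : ℝ≥0∞)))) t ≤
        rearr nuPos (fun x => (‖g x‖₊ : ℝ≥0∞)) (3 / 2 * t)) := by
  have h1 : MeasurableSet G1 := MeasurableSet.iUnion fun _ => measurableSet_Ioo
  have h2 : MeasurableSet G2 := MeasurableSet.iUnion fun _ => measurableSet_Ioo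
  constructor
  · filter_upwards [ae_restrict_mem (measurableSet_Ioi (a := (0 : ℝ)))] with t ht
    exact rearr_indicator_le _ G1 h1 G1_no_double t ht
  · filter_upwards [ae_restrict_mem (measurableSet_Ioi (a := (0 : ℝ)))] with t ht
    exact rearr_indicator_le _ G2 h2 G2_no_double t ht
end
end
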